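/- arXiv:1811.05457 — 2 statements merged into one kernel-verified Lean document; each statement's English description precedes it below -/
import Mathlib

section
/- Let 𝒪 ⊂ ℝ^{m−1} × ℝ^n be open and let ψ : 𝒪 → ℝ be uniformly intrinsically differentiable at every point of 𝒪, with intrinsic gradient ∇^ψψ. Then w := ∇^ψψ ∈ C(𝒪, ℝ^{m−1}) and: (a) for every j = 2,…,m and every η ∈ C_c^∞(𝒪, ℝ), ∫_𝒪 [ ψ·∂_{x_j}η + Σ_{s=1}^n ( ½ψ²·b^s_{j1} + ½(Σ_{l=2}^m x_l·b^s_{jl})·ψ )·∂_{y_s}η ] dL^{m+n−1} = −∫_𝒪 w_j·η dL^{m+n−1}; (b) there exists a family (ψ_ε)_{ε∈(0,1)} ⊂ C¹(𝒪, ℝ) such that for every compact K ⊂ 𝒪 and every j = 2,…,m, ψ_ε → ψ and D_j^{ψ_ε}ψ_ε → w_j uniformly on K as ε → 0⁺. -/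
noncomputable section

open Set Filter Topology MeasureTheory

namespace Carnot

/-- Euclidean norm on `Fin d → ℝ`. -/
def enorm {d : ℕ} (x : Fin d → ℝ) : ℝ := Real.sqrt (∑ i, (x i) ^ 2)

/-- The underlying set of the Carnot group `G = ℝ^m × ℝ^n` of class `𝓑`. -/
abbrev G (m n : ℕ) := (Fin m → ℝ) × (Fin n → ℝ)

/-- Points of the normal complement `W`, identified with `ℝ^(m-k) × ℝ^n`. -/
abbrev W (m n k : ℕ) := (Fin (m - k) → ℝ) × (Fin n → ℝ)

/-- The group law of the Carnot group of class `𝓑` associated with the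
skew-symmetric matrices `b s`:
`(x,y)·(x',y') = (x + x', y + y' + ½⟨Bx,x'⟩)`. -/
def gmul {m n : ℕ} (b : Fin n → Matrix (Fin m) (Fin m) ℝ) (P Q : G m n) : G m n :=
  (P.1 + Q.1, fun s => P.2 s + Q.2 s + (1 / 2) * ∑ i, ∑ j, b s i j * P.1 j * Q.1 i)

/-- The group inverse `(x,y)⁻¹ = (-x,-y)`. -/
def ginv {m n : ℕ} (P : G m n) : G m n := (-P.1, -P.2)

/-- The homogeneous quasi-norm `N(x,y) = |x| + |y|^(1/2)`. -/
def qnorm {m n : ℕ} (P : G m n) : ℝ := enorm P.1 + Real.sqrt (enorm P.2)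

/-- Open ball for the quasi-norm: `U(P,r) = {Q : N(P⁻¹·Q) < r}`. -/
def ball (m n : ℕ) (b : Fin n → Matrix (Fin m) (Fin m) ℝ) (P : G m n) (r : ℝ) : Set (G m n) :=
  {Q | qnorm (gmul b (ginv P) Q) < r}

/-- The embedding `i : ℝ^(m-k) × ℝ^n → G`, `i(a,α) = (0,…,0,a,α)`. -/
def embW (m n k : ℕ) (A : W m n k) : G m n :=
  (fun j => if h : (j : ℕ) < k then 0 else A.1 ⟨(j : ℕ) - k, by have := j.isLt; omega⟩, A.2)

/-- The embedding of `ℝ^k` as the horizontal subgroup `H`, `v ↦ (v,0,…,0)`. -/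
def embH (m n k : ℕ) (v : Fin k → ℝ) : G m n :=
  (fun j => if h : (j : ℕ) < k then v ⟨(j : ℕ), h⟩ else 0, 0)

/-- The graph map `Φ(A) = i(A)·φ̂(A)`. -/
def graphMap (m n k : ℕ) (b : Fin n → Matrix (Fin m) (Fin m) ℝ)
    (φ : W m n k → Fin k → ℝ) (A : W m n k) : G m n :=
  gmul b (embW m n k A) (embH m n k (φ A))

/-- `N(i(A)⁻¹·i(B))`. -/
def dW (m n k : ℕ) (b : Fin n → Matrix (Fin m) (Fin m) ℝ) (A B : W m n k) : ℝ :=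
  qnorm (gmul b (ginv (embW m n k A)) (embW m n k B))

/-- The graph quasi-distance `σ_φ(A,B) = N(φ̂(A)⁻¹·i(A)⁻¹·i(B)·φ̂(A))`. -/
def sigma (m n k : ℕ) (b : Fin n → Matrix (Fin m) (Fin m) ℝ)
    (φ : W m n k → Fin k → ℝ) (A B : W m n k) : ℝ :=
  qnorm (gmul b (gmul b (gmul b (ginv (embH m n k (φ A))) (ginv (embW m n k A)))
    (embW m n k B)) (embH m n k (φ A)))

/-- The matrix `M` satisfies the uniform intrinsic differentiability condition of `φ`
at `A₀ ∈ 𝒪`. -/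
def UID (m n k : ℕ) (b : Fin n → Matrix (Fin m) (Fin m) ℝ) (O : Set (W m n k))
    (φ : W m n k → Fin k → ℝ) (A₀ : W m n k) (M : Matrix (Fin k) (Fin (m - k)) ℝ) : Prop :=
  ∀ ε > 0, ∃ r > 0, ∀ A ∈ O, ∀ B ∈ O,
    dW m n k b A₀ A < r → dW m n k b A B < r → 0 < dW m n k b A B →
    enorm (fun j => φ B j - φ A j - ∑ i, M j i * (B.1 i - A.1 i)) ≤ ε * sigma m n k b φ A B

/-- `f : U → ℝ^k` is of class `C¹_G` with (continuous) horizontal Jacobian `gradf`. -/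
def C1G (m n k : ℕ) (b : Fin n → Matrix (Fin m) (Fin m) ℝ) (U : Set (G m n))
    (f : G m n → Fin k → ℝ) (gradf : G m n → Matrix (Fin k) (Fin m) ℝ) : Prop :=
  ContinuousOn f U ∧ ContinuousOn gradf U ∧
  ∀ P ∈ U, ∀ ε > 0, ∃ r > 0, ∀ Q ∈ U,
    qnorm (gmul b (ginv P) Q) < r →
    enorm (fun j => f Q j - f P j - ∑ i, gradf P j i * (Q.1 i - P.1 i)) ≤
      ε * qnorm (gmul b (ginv P) Q)

/-- The square block `M₁(Q) = (X_i f_j(Q))_{j,i=1,…,k}` of the horizontal Jacobian. -/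
def M1 (m n k : ℕ) (hk : k ≤ m) (gradf : G m n → Matrix (Fin k) (Fin m) ℝ) (Q : G m n) :
    Matrix (Fin k) (Fin k) ℝ :=
  Matrix.of fun j i => gradf Q j (Fin.castLE hk i)

/-- The block `M₂(Q) = (X_{k+i} f_j(Q))_{j=1,…,k; i=1,…,m-k}` of the horizontal Jacobian. -/
def M2 (m n k : ℕ) (gradf : G m n → Matrix (Fin k) (Fin m) ℝ) (Q : G m n) :
    Matrix (Fin k) (Fin (m - k)) ℝ :=
  Matrix.of fun j i => gradf Q j ⟨k + (i : ℕ), by have := i.isLt; omega⟩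

/-! ### The codimension-one case `k = 1` -/

/-- The index of the variable `x_{j+1}`, `j ∈ {2,…,m}`, inside `Fin m`
(recall that points of `ℝ^{m-1} × ℝ^n` are written `(x₂,…,x_m,y₁,…,y_n)`). -/
def idx1 (m : ℕ) (i : Fin (m - 1)) : Fin m := ⟨(i : ℕ) + 1, by have := i.isLt; omega⟩

/-- Scalar version of `C1G`: `f : U → ℝ` of class `C¹_G` with horizontal
gradient `∇_G f = (X₁f,…,X_mf)`. -/
def C1Gs (m n : ℕ) (b : Fin n → Matrix (Fin m) (Fin m) ℝ) (U : Set (G m n))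
    (f : G m n → ℝ) (gradf : G m n → Fin m → ℝ) : Prop :=
  ContinuousOn f U ∧ ContinuousOn gradf U ∧
  ∀ P ∈ U, ∀ ε > 0, ∃ r > 0, ∀ Q ∈ U,
    qnorm (gmul b (ginv P) Q) < r →
    |f Q - f P - ∑ i, gradf P i * (Q.1 i - P.1 i)| ≤ ε * qnorm (gmul b (ginv P) Q)

/-- `ψ : 𝒪 → ℝ` is uniformly intrinsically differentiable at `A₀` with intrinsic
gradient `g ∈ ℝ^{m-1}` (scalar version of `UID`). -/
def UIDs (m n : ℕ) (b : Fin n → Matrix (Fin m) (Fin m) ℝ) (O : Set (W m n 1))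
    (ψ : W m n 1 → ℝ) (A₀ : W m n 1) (g : Fin (m - 1) → ℝ) : Prop :=
  ∀ ε > 0, ∃ r > 0, ∀ A ∈ O, ∀ B ∈ O,
    dW m n 1 b A₀ A < r → dW m n 1 b A B < r → 0 < dW m n 1 b A B →
    |ψ B - ψ A - ∑ i, g i * (B.1 i - A.1 i)| ≤
      ε * sigma m n 1 b (fun A' _ => ψ A') A B

/-- The graph map `Φ(A) = i(A)·ψ̂(A)` for a scalar `ψ`. -/
def graphMapS (m n : ℕ) (b : Fin n → Matrix (Fin m) (Fin m) ℝ)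
    (ψ : W m n 1 → ℝ) (A : W m n 1) : G m n :=
  graphMap m n 1 b (fun A' _ => ψ A') A

/-- The intrinsic derivative `D_j^ψ ψ` of a (C¹) function `ψ : ℝ^{m-1} × ℝ^n → ℝ`:
`D_j^ψψ = ∂_{x_j}ψ + Σ_s (ψ b^s_{j1} + ½ Σ_l x_l b^s_{jl}) ∂_{y_s}ψ`. -/
def Dj (m n : ℕ) (h0 : 0 < m) (b : Fin n → Matrix (Fin m) (Fin m) ℝ)
    (ψ : W m n 1 → ℝ) (j : Fin (m - 1)) (A : W m n 1) : ℝ :=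
  fderiv ℝ ψ A ((Pi.single j 1 : Fin (m - 1) → ℝ), (0 : Fin n → ℝ)) +
    ∑ s, (ψ A * b s (idx1 m j) ⟨0, h0⟩ +
        (1 / 2) * ∑ l, A.1 l * b s (idx1 m j) (idx1 m l)) *
      fderiv ℝ ψ A ((0 : Fin (m - 1) → ℝ), (Pi.single s 1 : Fin n → ℝ))

/-- Euclidean norm on `ℝ^d × ℝ^e`. -/
def enormP {d e : ℕ} (P : (Fin d → ℝ) × (Fin e → ℝ)) : ℝ :=
  Real.sqrt (∑ i, (P.1 i) ^ 2 + ∑ s, (P.2 s) ^ 2)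

/-- Closed Euclidean ball in `ℝ^d × ℝ^e`. -/
def cballE {d e : ℕ} (A : (Fin d → ℝ) × (Fin e → ℝ)) (r : ℝ) :
    Set ((Fin d → ℝ) × (Fin e → ℝ)) :=
  {B | enormP (B - A) ≤ r}

/-- `ψ` is a broad* solution of `(D₂^ψψ,…,D_m^ψψ) = w` in `𝒪`: around every point
there are exponential maps of the vector fields `D_j^ψ` along which `ψ(γ(t)) − ψ(γ(0))`
is the integral of `w_j ∘ γ`. -/
def IsBroadStar (m n : ℕ) (h0 : 0 < m) (b : Fin n → Matrix (Fin m) (Fin m) ℝ)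
    (O : Set (W m n 1)) (ψ : W m n 1 → ℝ) (w : W m n 1 → Fin (m - 1) → ℝ) : Prop :=
  ∀ A ∈ O, ∃ δ₁ δ₂ : ℝ, 0 < δ₂ ∧ δ₂ < δ₁ ∧ cballE A δ₁ ⊆ O ∧
    ∀ j : Fin (m - 1), ∃ γ : ℝ → W m n 1 → W m n 1,
      ∀ B ∈ cballE A δ₂,
        (∀ t ∈ Set.Icc (-δ₂) δ₂, γ t B ∈ cballE A δ₁) ∧
        γ 0 B = B ∧
        (∀ h : Fin (m - 1), ∀ t ∈ Set.Icc (-δ₂) δ₂,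
          HasDerivAt (fun t' => (γ t' B).1 h) (if h = j then 1 else 0) t) ∧
        (∀ s : Fin n, ∀ t ∈ Set.Icc (-δ₂) δ₂,
          HasDerivAt (fun t' => (γ t' B).2 s)
            (ψ (γ t B) * b s (idx1 m j) ⟨0, h0⟩ +
              (1 / 2) * ∑ l, (γ t B).1 l * b s (idx1 m j) (idx1 m l)) t) ∧
        (∀ t ∈ Set.Icc (-δ₂) δ₂, ψ (γ t B) - ψ B = ∫ r in (0:ℝ)..t, w (γ r B) j)

section ParametricIntegral

variable {H P V : Type*} [NormedAddCommGroup H] [NormedSpace ℝ H] [FiniteDimensional ℝ H]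
  [MeasurableSpace H] [BorelSpace H] [NormedAddCommGroup P] [NormedSpace ℝ P]

theorem hasFDerivAt_setIntegral_param (μ : Measure H) [IsFiniteMeasureOnCompacts μ]
    {Θ : P × H → ℝ} (hΘ : ContDiff ℝ 1 Θ) {h : H → P} (hh : Continuous h)
    {L : Set H} (hL : IsCompact L) (A : H) :
    HasFDerivAt (fun A => ∫ C in L, Θ (h C, A - C) ∂μ)
      (∫ C in L, (fderiv ℝ Θ (h C, A - C)).comp (ContinuousLinearMap.inr ℝ P H) ∂μ) A := by
  have hcont : Continuous fun z : H × H => Θ (h z.2, z.1 - z.2) :=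
    hΘ.continuous.comp (by fun_prop)
  have hcont' : Continuous fun z : H × H =>
      (fderiv ℝ Θ (h z.2, z.1 - z.2)).comp (ContinuousLinearMap.inr ℝ P H) :=
    ((hΘ.continuous_fderiv one_ne_zero).comp (by fun_prop :
      Continuous fun z : H × H => (h z.2, z.1 - z.2))).clm_comp continuous_const
  obtain ⟨M, hM⟩ := ((isCompact_closedBall A 1).prod hL).exists_bound_of_continuousOn
    hcont'.continuousOn
  have : IsFiniteMeasure (μ.restrict L) := ⟨by simpa using hL.measure_lt_top⟩
  refine hasFDerivAt_integral_of_dominated_of_fderiv_le (bound := fun _ => M)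
    (F := fun A C => Θ (h C, A - C))
    (F' := fun A C => (fderiv ℝ Θ (h C, A - C)).comp (ContinuousLinearMap.inr ℝ P H))
    (Metric.ball_mem_nhds A one_pos) ?_ ?_ ?_ ?_ ?_ ?_
  · exact Eventually.of_forall fun x =>
      (hcont.comp (by fun_prop : Continuous fun C : H => (x, C))).aestronglyMeasurable
  · exact ((hcont.comp
      (by fun_prop : Continuous fun C : H => (A, C))).continuousOn).integrableOn_compact hL
  · exact (hcont'.comp (by fun_prop : Continuous fun C : H => (A, C))).aestronglyMeasurable
  · refine (ae_restrict_mem hL.measurableSet).mono fun C hC x hx => ?_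
    exact hM (x, C) ⟨Metric.ball_subset_closedBall hx, hC⟩
  · exact integrable_const _
  · refine Eventually.of_forall fun C x _ => ?_
    have h1 : HasFDerivAt (fun x : H => (h C, x - C)) (ContinuousLinearMap.inr ℝ P H) x :=
      (hasFDerivAt_const (h C) x).prodMk ((hasFDerivAt_id x).sub_const C)
    exact ((hΘ.differentiable one_ne_zero) _).hasFDerivAt.comp x h1

theorem contDiff_setIntegral_param (μ : Measure H) [IsFiniteMeasureOnCompacts μ]
    {Θ : P × H → ℝ} (hΘ : ContDiff ℝ 1 Θ) {h : H → P} (hh : Continuous h)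
    {L : Set H} (hL : IsCompact L) :
    ContDiff ℝ 1 fun A => ∫ C in L, Θ (h C, A - C) ∂μ := by
  have hd := hasFDerivAt_setIntegral_param μ hΘ hh hL
  refine contDiff_one_iff_fderiv.2 ⟨fun A => (hd A).differentiableAt, ?_⟩
  rw [show fderiv ℝ (fun A => ∫ C in L, Θ (h C, A - C) ∂μ) = _ from funext fun A => (hd A).fderiv]
  refine continuous_parametric_integral_of_continuous (f := fun A C =>
    (fderiv ℝ Θ (h C, A - C)).comp (ContinuousLinearMap.inr ℝ P H)) ?_ hL
  exact ((hΘ.continuous_fderiv one_ne_zero).comp (by fun_prop :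
      Continuous fun z : H × H => (h z.2, z.1 - z.2))).clm_comp continuous_const

theorem fderiv_setIntegral_param_apply (μ : Measure H) [IsFiniteMeasureOnCompacts μ]
    {Θ : P × H → ℝ} (hΘ : ContDiff ℝ 1 Θ) {h : H → P} (hh : Continuous h)
    {L : Set H} (hL : IsCompact L) (A v : H) :
    fderiv ℝ (fun A => ∫ C in L, Θ (h C, A - C) ∂μ) A v =
      ∫ C in L, fderiv ℝ Θ (h C, A - C) (0, v) ∂μ := by
  rw [(hasFDerivAt_setIntegral_param μ hΘ hh hL A).fderiv,
    ContinuousLinearMap.integral_apply]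
  · rfl
  · refine ContinuousOn.integrableOn_compact hL (Continuous.continuousOn ?_)
    exact ((hΘ.continuous_fderiv one_ne_zero).comp (by fun_prop :
      Continuous fun C : H => (h C, A - C))).clm_comp continuous_const

end ParametricIntegral

section Shear

variable {E F : Type*} [NormedAddCommGroup E] [NormedSpace ℝ E]
  [NormedAddCommGroup F] [NormedSpace ℝ F]

/-- The anisotropic rescaling by `t` of the shear `(x, y) ↦ (x, y - a x)`. -/
def shear (a : E →L[ℝ] F) (t : ℝ) : E × F →L[ℝ] E × F :=
  (t⁻¹ • ContinuousLinearMap.fst ℝ E F).prod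
    ((t ^ 2)⁻¹ • (ContinuousLinearMap.snd ℝ E F - a.comp (ContinuousLinearMap.fst ℝ E F)))

theorem shear_apply (a : E →L[ℝ] F) (t : ℝ) (z : E × F) :
    shear a t z = (t⁻¹ • z.1, (t ^ 2)⁻¹ • (z.2 - a z.1)) := rfl

theorem norm_shear_le_iff (a : E →L[ℝ] F) {t : ℝ} (ht : 0 < t) (z : E × F) (c : ℝ) :
    ‖shear a t z‖ ≤ c ↔ ‖z.1‖ ≤ c * t ∧ ‖z.2 - a z.1‖ ≤ c * t ^ 2 := by
  rw [shear_apply, Prod.norm_def, max_le_iff, norm_smul, norm_smul, norm_inv, norm_inv,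
    Real.norm_of_nonneg ht.le, Real.norm_of_nonneg (by positivity : 0 ≤ t ^ 2),
    inv_mul_le_iff₀ ht, inv_mul_le_iff₀ (by positivity), mul_comm t, mul_comm (t ^ 2)]

theorem contDiff_shear (t : ℝ) :
    ContDiff ℝ 1 fun u : (ℝ × (E →L[ℝ] ℝ) × (E →L[ℝ] F)) × (E × F) => shear u.1.2.2 t u.2 := by
  simp only [shear_apply]
  fun_prop

theorem fderiv_comp_zero_prod {P H : Type*} [NormedAddCommGroup P] [NormedSpace ℝ P]
    [NormedAddCommGroup H] [NormedSpace ℝ H] {Θ : P × H → ℝ} (hΘ : ContDiff ℝ 1 Θ) (c : P)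
    (z v : H) {D : H →L[ℝ] ℝ} (hD : HasFDerivAt (fun z => Θ (c, z)) D z) :
    fderiv ℝ Θ (c, z) (0, v) = D v := by
  have h1 : HasFDerivAt (fun x : H => (c, x)) (ContinuousLinearMap.inr ℝ P H) z :=
    (hasFDerivAt_const c z).prodMk (hasFDerivAt_id z)
  rw [hD.unique (((hΘ.differentiable one_ne_zero) _).hasFDerivAt.comp z h1)]
  rfl

/-- The sheared kernel at scale `t`. -/
def kernelZ (φ : E × F → ℝ) (t : ℝ) (u : (ℝ × (E →L[ℝ] ℝ) × (E →L[ℝ] F)) × (E × F)) : ℝ :=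
  φ (shear u.1.2.2 t u.2)

/-- The sheared kernel at scale `t`, multiplied by a first order Taylor polynomial. -/
def kernelN (φ : E × F → ℝ) (t : ℝ) (u : (ℝ × (E →L[ℝ] ℝ) × (E →L[ℝ] F)) × (E × F)) : ℝ :=
  (u.1.1 + u.1.2.1 u.2.1) * kernelZ φ t u

variable {φ : E × F → ℝ}

theorem contDiff_kernelZ (hφ : ContDiff ℝ 1 φ) (t : ℝ) : ContDiff ℝ 1 (kernelZ φ t) :=
  hφ.comp (contDiff_shear t)

theorem contDiff_kernelN (hφ : ContDiff ℝ 1 φ) (t : ℝ) : ContDiff ℝ 1 (kernelN φ t) := by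
  have := contDiff_kernelZ hφ t
  unfold kernelN
  fun_prop

theorem hasFDerivAt_kernelZ (hφ : ContDiff ℝ 1 φ) (t : ℝ) (c : ℝ × (E →L[ℝ] ℝ) × (E →L[ℝ] F))
    (z : E × F) :
    HasFDerivAt (fun z => kernelZ φ t (c, z))
      ((fderiv ℝ φ (shear c.2.2 t z)).comp (shear c.2.2 t)) z :=
  ((hφ.differentiable one_ne_zero) _).hasFDerivAt.comp z (shear c.2.2 t).hasFDerivAt

theorem fderiv_kernelZ (hφ : ContDiff ℝ 1 φ) (t : ℝ) (c : ℝ × (E →L[ℝ] ℝ) × (E →L[ℝ] F))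
    (z v : E × F) :
    fderiv ℝ (kernelZ φ t) (c, z) (0, v) = fderiv ℝ φ (shear c.2.2 t z) (shear c.2.2 t v) :=
  fderiv_comp_zero_prod (contDiff_kernelZ hφ t) c z v (hasFDerivAt_kernelZ hφ t c z)

theorem fderiv_kernelN (hφ : ContDiff ℝ 1 φ) (t : ℝ) (c : ℝ × (E →L[ℝ] ℝ) × (E →L[ℝ] F))
    (z v : E × F) :
    fderiv ℝ (kernelN φ t) (c, z) (0, v) = c.2.1 v.1 * kernelZ φ t (c, z) +
      (c.1 + c.2.1 z.1) * fderiv ℝ φ (shear c.2.2 t z) (shear c.2.2 t v) := by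
  have h1 : HasFDerivAt (fun z : E × F => c.1 + c.2.1 z.1)
      (c.2.1.comp (ContinuousLinearMap.fst ℝ E F)) z :=
    (c.2.1.comp (ContinuousLinearMap.fst ℝ E F)).hasFDerivAt.const_add c.1
  have h2 := h1.mul (hasFDerivAt_kernelZ hφ t c z)
  rw [fderiv_comp_zero_prod (contDiff_kernelN hφ t) c z v h2]
  simp
  ring

theorem measureReal_shear_ratio {H : Type*} [NormedAddCommGroup H] [NormedSpace ℝ H]
    [FiniteDimensional ℝ H] [MeasurableSpace H] [BorelSpace H] (μ : Measure H)
    [μ.IsAddHaarMeasure] (Λ : H →L[ℝ] H) (A : H) {ρ R : ℝ} (hρ : 0 < ρ) (hR : 0 < R) :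
    μ.real {C | ‖Λ (A - C)‖ ≤ R} =
      (R / ρ) ^ Module.finrank ℝ H * μ.real {C | ‖Λ (A - C)‖ ≤ ρ} := by
  have hpos : 0 < R / ρ := div_pos hR hρ
  have : {C | ‖Λ (A - C)‖ ≤ R} =
      AffineMap.homothety A (R / ρ) '' {C | ‖Λ (A - C)‖ ≤ ρ} := by
    ext C
    constructor
    · intro hC
      refine ⟨AffineMap.homothety A (R / ρ)⁻¹ C, ?_, ?_⟩
      · have : A - AffineMap.homothety A (R / ρ)⁻¹ C = (R / ρ)⁻¹ • (A - C) := by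
          simp only [AffineMap.homothety_apply, vsub_eq_sub, vadd_eq_add, smul_sub]
          abel
        simp only [mem_ofPred_eq, this, map_smul, norm_smul, norm_inv, Real.norm_of_nonneg hpos.le]
        rw [inv_mul_le_iff₀ hpos]
        simpa [div_mul_cancel₀ R hρ.ne'] using hC
      · simp only [AffineMap.homothety_apply, vsub_eq_sub, vadd_eq_add, add_sub_cancel_right,
          smul_smul, mul_inv_cancel₀ hpos.ne', one_smul, sub_add_cancel]
    · rintro ⟨C, hC, rfl⟩
      have : A - AffineMap.homothety A (R / ρ) C = (R / ρ) • (A - C) := by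
        simp only [AffineMap.homothety_apply, vsub_eq_sub, vadd_eq_add, smul_sub]
        abel
      simp only [mem_ofPred_eq, this, map_smul, norm_smul, Real.norm_of_nonneg hpos.le]
      calc R / ρ * ‖Λ (A - C)‖ ≤ R / ρ * ρ := by gcongr; exact hC
        _ = R := div_mul_cancel₀ R hρ.ne'
  rw [this, measureReal_def, Measure.addHaar_image_homothety, ENNReal.toReal_mul,
    ENNReal.toReal_ofReal (abs_nonneg _), abs_of_pos (pow_pos hpos _), measureReal_def]

end Shear

section Approximation

variable {E F : Type*} [NormedAddCommGroup E] [NormedSpace ℝ E]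
  [NormedAddCommGroup F] [NormedSpace ℝ F]

/-- The coefficient `ψ(A) β + γ(x_A)` of the vector fields `D^ψ` at `A`. -/
def drift (β : E →L[ℝ] F) (γ : E →L[ℝ] E →L[ℝ] F) (p : E × F → ℝ) (A : E × F) : E →L[ℝ] F :=
  p A • β + γ A.1

/-- The first order expansion of `p` with differential `ω`, up to an error `ε` relative to the
graph quasi-distance, for all pairs of points in the ball of centre `A₀` and radius `r`. -/
def ExpandsOn (β : E →L[ℝ] F) (γ : E →L[ℝ] E →L[ℝ] F) (p : E × F → ℝ) (ω : E →L[ℝ] ℝ)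
    (A₀ : E × F) (ε r : ℝ) : Prop :=
  ∀ A ∈ Metric.ball A₀ r, ∀ B ∈ Metric.ball A₀ r,
    |p B - p A - ω (B.1 - A.1)| ≤
      ε * (‖B.1 - A.1‖ + √‖B.2 - A.2 - drift β γ p A (B.1 - A.1)‖)

variable {β : E →L[ℝ] F} {γ : E →L[ℝ] E →L[ℝ] F} {p : E × F → ℝ} {ω : E →L[ℝ] ℝ} {A₀ : E × F}
  {ε r t c : ℝ}

theorem ExpandsOn.abs_sub_sub_le (h : ExpandsOn β γ p ω A₀ ε r) (hε : 0 ≤ ε) (ht : 0 < t)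
    (hc2 : c ≤ 2) {A B : E × F} (hA : A ∈ Metric.ball A₀ r)
    (hB : B ∈ Metric.ball A₀ r) (hs : ‖shear (drift β γ p A) t (B - A)‖ ≤ c) :
    |p B - p A - ω (B.1 - A.1)| ≤ 4 * ε * t := by
  obtain ⟨h1, h2⟩ := (norm_shear_le_iff _ ht _ _).1 hs
  simp only [Prod.fst_sub, Prod.snd_sub] at h1 h2
  have h3 : √‖B.2 - A.2 - drift β γ p A (B.1 - A.1)‖ ≤ 2 * t := by
    rw [Real.sqrt_le_left (by positivity)]
    nlinarith [sq_nonneg t]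
  calc _ ≤ _ := h A hA B hB
    _ ≤ ε * (2 * t + 2 * t) := by gcongr; nlinarith
    _ = 4 * ε * t := by ring

theorem ExpandsOn.abs_sub_le (h : ExpandsOn β γ p ω A₀ ε r) (hε : 0 ≤ ε) (hε1 : ε ≤ 1)
    (ht : 0 < t) (hc2 : c ≤ 2) {A B : E × F} (hA : A ∈ Metric.ball A₀ r)
    (hB : B ∈ Metric.ball A₀ r) (hs : ‖shear (drift β γ p A) t (B - A)‖ ≤ c) :
    |p B - p A| ≤ (2 * ‖ω‖ + 4) * t := by
  have h1 := h.abs_sub_sub_le hε ht hc2 hA hB hs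
  have h2 : |ω (B.1 - A.1)| ≤ ‖ω‖ * (2 * t) := by
    refine (ω.le_opNorm _).trans ?_
    gcongr
    have := ((norm_shear_le_iff _ ht _ _).1 hs).1
    simp only [Prod.fst_sub] at this
    nlinarith
  have h3 := abs_add_le (p B - p A - ω (B.1 - A.1)) (ω (B.1 - A.1))
  rw [sub_add_cancel] at h3
  nlinarith

theorem norm_drift_sub_le {k : ℝ} (p' : E × F → ℝ) {A B : E × F} (hp : |p' A - p B| ≤ k * t)
    (hx : ‖A.1 - B.1‖ ≤ 2 * t) (ξ : E) :
    ‖drift β γ p' A ξ - drift β γ p B ξ‖ ≤ (k * ‖β‖ + 2 * ‖γ‖) * t * ‖ξ‖ := by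
  have : drift β γ p' A ξ - drift β γ p B ξ = (p' A - p B) • β ξ + γ (A.1 - B.1) ξ := by
    simp only [drift, add_apply, smul_apply, map_sub,
      sub_apply, sub_smul]
    abel
  rw [this]
  calc _ ≤ ‖(p' A - p B) • β ξ‖ + ‖γ (A.1 - B.1) ξ‖ := norm_add_le _ _
    _ ≤ (k * t) * (‖β‖ * ‖ξ‖) + ‖γ‖ * (2 * t) * ‖ξ‖ := by
        gcongr
        · rw [norm_smul]
          exact mul_le_mul hp (β.le_opNorm ξ) (norm_nonneg _) ((abs_nonneg _).trans hp)
        · exact (γ.le_opNorm₂ _ _).trans (by gcongr)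
    _ = _ := by ring

theorem norm_shear_drift_le {k : ℝ} (ht : 0 < t) {A B : E × F}
    (hp : |p A - p B| ≤ k * t) (hx : ‖A.1 - B.1‖ ≤ 2 * t) {z : E × F}
    (hz : ‖shear (drift β γ p A) t z‖ ≤ c) :
    ‖shear (drift β γ p B) t z‖ ≤ c * (1 + k * ‖β‖ + 2 * ‖γ‖) := by
  have hk : 0 ≤ k := nonneg_of_mul_nonneg_left ((abs_nonneg _).trans hp) ht
  have hc : 0 ≤ c := (norm_nonneg _).trans hz
  obtain ⟨h1, h2⟩ := (norm_shear_le_iff _ ht _ _).1 hz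
  have hβ : 0 ≤ k * ‖β‖ + 2 * ‖γ‖ := by positivity
  refine (norm_shear_le_iff _ ht _ _).2 ⟨h1.trans ?_, ?_⟩
  · gcongr
    nlinarith
  · have h3 := norm_drift_sub_le (β := β) (γ := γ) p hp hx z.1
    have h4 : z.2 - drift β γ p B z.1 =
      (z.2 - drift β γ p A z.1) + (drift β γ p A z.1 - drift β γ p B z.1) := by abel
    rw [h4]
    refine (norm_add_le _ _).trans ?_
    have h5 : (k * ‖β‖ + 2 * ‖γ‖) * t * ‖z.1‖ ≤ (k * ‖β‖ + 2 * ‖γ‖) * t * (c * t) := by gcongr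
    nlinarith

theorem norm_sub_le_of_shear {a : E →L[ℝ] F} {M : ℝ} (ha : ‖a‖ ≤ M) (ht : 0 < t) (ht1 : t ≤ 1)
    {z : E × F} (hz : ‖shear a t z‖ ≤ 2) : ‖z‖ ≤ (2 + 2 * M) * t := by
  have hM : 0 ≤ M := (norm_nonneg _).trans ha
  obtain ⟨h1, h2⟩ := (norm_shear_le_iff _ ht _ _).1 hz
  rw [Prod.norm_def, max_le_iff]
  constructor
  · nlinarith
  · calc ‖z.2‖ = ‖(z.2 - a z.1) + a z.1‖ := by rw [sub_add_cancel]
      _ ≤ ‖z.2 - a z.1‖ + ‖a z.1‖ := norm_add_le _ _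
      _ ≤ 2 * t ^ 2 + M * (2 * t) := by
        gcongr
        exact (a.le_opNorm _).trans (by gcongr)
      _ ≤ _ := by nlinarith

theorem ExpandsOn.continuousAt {ε : ℝ} (h : ExpandsOn β γ p ω A₀ ε r) (hr : 0 < r) :
    ContinuousAt p A₀ := by
  have h0 : Tendsto (fun B : E × F => |ω (B.1 - A₀.1)| +
      ε * (‖B.1 - A₀.1‖ + √‖B.2 - A₀.2 - drift β γ p A₀ (B.1 - A₀.1)‖)) (𝓝 A₀) (𝓝 0) := by
    have : Continuous fun B : E × F => |ω (B.1 - A₀.1)| +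
      ε * (‖B.1 - A₀.1‖ + √‖B.2 - A₀.2 - drift β γ p A₀ (B.1 - A₀.1)‖) := by fun_prop
    simpa using this.tendsto A₀
  refine tendsto_iff_dist_tendsto_zero.2 (squeeze_zero' (Eventually.of_forall fun _ => dist_nonneg)
    ?_ h0)
  filter_upwards [Metric.ball_mem_nhds A₀ hr] with B hB
  have h1 := h A₀ (Metric.mem_ball_self hr) B hB
  have h2 := abs_add_le (p B - p A₀ - ω (B.1 - A₀.1)) (ω (B.1 - A₀.1))
  rw [sub_add_cancel] at h2
  rw [Real.dist_eq]
  linarith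

theorem ExpandsOn.norm_sub_le {ω' : E →L[ℝ] ℝ} {A₁ : E × F} {ε r' : ℝ} (hε : 0 ≤ ε)
    (h : ExpandsOn β γ p ω A₀ ε r) (h' : ExpandsOn β γ p ω' A₁ ε r') (hr' : 0 < r')
    (hA₁ : A₁ ∈ Metric.ball A₀ r) : ‖ω' - ω‖ ≤ 2 * ε := by
  refine ContinuousLinearMap.opNorm_le_bound _ (by positivity) fun ξ => ?_
  have hev : ∀ᶠ s : ℝ in 𝓝[>] 0, A₁ + s • (ξ, drift β γ p A₁ ξ) ∈
      Metric.ball A₀ r ∩ Metric.ball A₁ r' := by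
    have hc : ContinuousAt (fun s : ℝ => A₁ + s • (ξ, drift β γ p A₁ ξ)) 0 := by fun_prop
    refine (hc.eventually_mem ?_).filter_mono nhdsWithin_le_nhds
    rw [zero_smul, add_zero]
    exact (Metric.isOpen_ball.inter Metric.isOpen_ball).mem_nhds
      ⟨hA₁, Metric.mem_ball_self hr'⟩
  obtain ⟨s, ⟨hs1, hs2⟩, hs⟩ := (hev.and self_mem_nhdsWithin).exists
  have hs0 : (0 : ℝ) < s := hs
  have h1 := h A₁ hA₁ _ hs1
  have h2 := h' A₁ (Metric.mem_ball_self hr') _ hs2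
  simp only [Prod.fst_add, Prod.smul_fst, add_sub_cancel_left, Prod.snd_add, Prod.smul_snd,
    map_smul, smul_eq_mul, sub_self, norm_zero, Real.sqrt_zero, add_zero, norm_smul,
    Real.norm_eq_abs, abs_of_pos hs0] at h1 h2
  have h3 := _root_.abs_sub_le (s * ω' ξ)
    (p (A₁ + s • (ξ, drift β γ p A₁ ξ)) - p A₁) (s * ω ξ)
  rw [abs_sub_comm] at h2
  rw [← mul_sub, abs_mul, abs_of_pos hs0] at h3
  rw [sub_apply, Real.norm_eq_abs]
  refine le_of_mul_le_mul_left ?_ hs0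
  linarith

theorem continuousOn_of_expandsOn {O : Set (E × F)} {w : E × F → E →L[ℝ] ℝ}
    (hexp : ∀ A₀ ∈ O, ∀ ε > 0, ∃ r > 0, ExpandsOn β γ p (w A₀) A₀ ε r) :
    ContinuousOn p O ∧ ContinuousOn w O := by
  refine ⟨fun A hA => ?_, fun A hA => ?_⟩
  · obtain ⟨r, hr, h⟩ := hexp A hA 1 one_pos
    exact (h.continuousAt hr).continuousWithinAt
  · refine Metric.continuousWithinAt_iff.2 fun ε hε => ?_
    obtain ⟨r, hr, h⟩ := hexp A hA (ε / 3) (by positivity)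
    refine ⟨r, hr, fun B hB hBA => ?_⟩
    obtain ⟨r', hr', h'⟩ := hexp B hB (ε / 3) (by positivity)
    rw [dist_eq_norm]
    linarith [h.norm_sub_le (by positivity) h' hr' (Metric.mem_ball.2 hBA)]

set_option linter.unusedSectionVars false

/-- The parameters of the sheared kernel with centre `C`. -/
def kernelParam (β : E →L[ℝ] F) (γ : E →L[ℝ] E →L[ℝ] F) (p : E × F → ℝ)
    (q : E × F → E →L[ℝ] ℝ) (C : E × F) : ℝ × (E →L[ℝ] ℝ) × (E →L[ℝ] F) :=
  (p C, q C, drift β γ p C)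

theorem continuous_drift (hp : Continuous p) : Continuous (drift β γ p) := by
  unfold drift
  fun_prop

theorem continuous_kernelParam {q : E × F → E →L[ℝ] ℝ} (hp : Continuous p) (hq : Continuous q) :
    Continuous (kernelParam β γ p q) :=
  hp.prodMk (hq.prodMk (continuous_drift hp))

theorem norm_shear_graph_le {ε' : ℝ} (ht : 0 < t) {f : E × F → ℝ} {A C : E × F}
    (hf : |f A - p C| ≤ ε' * t) (hx : ‖A.1 - C.1‖ ≤ 2 * t) (ξ : E) :
    ‖shear (drift β γ p C) t (ξ, drift β γ f A ξ)‖ ≤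
      (1 + ε' * ‖β‖ + 2 * ‖γ‖) * t⁻¹ * ‖ξ‖ := by
  have hk : 0 ≤ ε' := nonneg_of_mul_nonneg_left ((abs_nonneg _).trans hf) ht
  have hβ : 0 ≤ ε' * ‖β‖ + 2 * ‖γ‖ := by positivity
  refine (norm_shear_le_iff _ ht _ _).2 ⟨?_, ?_⟩
  · have : (1 + ε' * ‖β‖ + 2 * ‖γ‖) * t⁻¹ * ‖ξ‖ * t = (1 + ε' * ‖β‖ + 2 * ‖γ‖) * ‖ξ‖ := by
      field_simp
    rw [this]
    nlinarith [norm_nonneg ξ]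
  · have : (1 + ε' * ‖β‖ + 2 * ‖γ‖) * t⁻¹ * ‖ξ‖ * t ^ 2 =
      (1 + ε' * ‖β‖ + 2 * ‖γ‖) * t * ‖ξ‖ := by
      field_simp
    rw [this]
    refine (norm_drift_sub_le (β := β) (γ := γ) f hf hx ξ).trans ?_
    gcongr
    linarith

variable [FiniteDimensional ℝ E] [FiniteDimensional ℝ F]
  [MeasurableSpace E] [BorelSpace E] [MeasurableSpace F] [BorelSpace F]

/-- The total mass at `A` of the sheared kernels with centre in `L`. -/
def massZ (μ : Measure (E × F)) (φ : E × F → ℝ) (β : E →L[ℝ] F) (γ : E →L[ℝ] E →L[ℝ] F)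
    (p : E × F → ℝ) (q : E × F → E →L[ℝ] ℝ) (L : Set (E × F)) (t : ℝ) (A : E × F) : ℝ :=
  ∫ C in L, kernelZ φ t (kernelParam β γ p q C, A - C) ∂μ

/-- The sheared kernel average at `A` of the Taylor polynomials with centre in `L`, before
normalization. -/
def massN (μ : Measure (E × F)) (φ : E × F → ℝ) (β : E →L[ℝ] F) (γ : E →L[ℝ] E →L[ℝ] F)
    (p : E × F → ℝ) (q : E × F → E →L[ℝ] ℝ) (L : Set (E × F)) (t : ℝ) (A : E × F) : ℝ :=
  ∫ C in L, kernelN φ t (kernelParam β γ p q C, A - C) ∂μ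

variable {μ : Measure (E × F)} [μ.IsAddHaarMeasure] {φ : E × F → ℝ} {q : E × F → E →L[ℝ] ℝ}
  {L : Set (E × F)} {A : E × F} {k M K : ℝ}

theorem integrableOn_param {Θ : (ℝ × (E →L[ℝ] ℝ) × (E →L[ℝ] F)) × (E × F) → ℝ}
    (hΘ : Continuous Θ) (hp : Continuous p) (hq : Continuous q) (hL : IsCompact L) :
    IntegrableOn (fun C => Θ (kernelParam β γ p q C, A - C)) L μ :=
  ((hΘ.comp ((continuous_kernelParam hp hq).prodMk
    (continuous_const.sub continuous_id))).continuousOn).integrableOn_compact hL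

theorem measureReal_shear_le_massZ (hφ : ContDiff ℝ 1 φ) (hφ0 : ∀ z, 0 ≤ φ z)
    (hφ1 : ∀ z, ‖z‖ ≤ 1 → φ z = 1) (hp : Continuous p) (hq : Continuous q) (hL : IsCompact L)
    {S : Set (E × F)} (hSm : MeasurableSet S)
    (hS : ∀ C ∈ S, C ∈ L ∧ ‖shear (drift β γ p C) t (A - C)‖ ≤ 1) :
    μ.real S ≤ massZ μ φ β γ p q L t A := by
  have hSL : S ⊆ L := fun C hC => (hS C hC).1
  have h1 : ∫ C in L, S.indicator (fun _ => (1 : ℝ)) C ∂μ = μ.real S := by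
    rw [integral_indicator_const _ hSm, measureReal_restrict_apply hSm,
      inter_eq_left.2 hSL, smul_eq_mul, mul_one]
  have : IsFiniteMeasure (μ.restrict L) := ⟨by simpa using hL.measure_lt_top⟩
  rw [← h1]
  refine integral_mono ((integrable_const _).indicator hSm)
    (integrableOn_param (contDiff_kernelZ hφ t).continuous hp hq hL) fun C => ?_
  by_cases hC : C ∈ S
  · rw [indicator_of_mem hC]
    exact (hφ1 _ (hS C hC).2).ge
  · rw [indicator_of_notMem hC]
    exact hφ0 _

theorem measureReal_shear_pos (hK : 0 < K) (hL : IsCompact L)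
    (hS : {C | ‖shear (drift β γ p A) t (A - C)‖ ≤ K} ⊆ L) :
    0 < μ.real {C | ‖shear (drift β γ p A) t (A - C)‖ ≤ K} := by
  have hmem : {C | ‖shear (drift β γ p A) t (A - C)‖ ≤ K} ∈ 𝓝 A := by
    have : ContinuousAt (fun C => ‖shear (drift β γ p A) t (A - C)‖) A := by fun_prop
    refine (this.eventually_lt continuousAt_const ?_).mono fun _ h => le_of_lt h
    simpa using hK
  exact ENNReal.toReal_pos (Measure.measure_pos_of_mem_nhds μ hmem).ne'
    ((measure_mono hS).trans_lt hL.measure_lt_top).ne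

theorem abs_massN_sub_le (hφ : ContDiff ℝ 1 φ) (hφ0 : ∀ z, 0 ≤ φ z)
    (hφ2 : ∀ z, 2 < ‖z‖ → φ z = 0) (hp : Continuous p) (hq : Continuous q) (hL : IsCompact L)
    {e : ℝ} (h : ∀ C ∈ L, ‖shear (drift β γ p C) t (A - C)‖ ≤ 2 →
      |p C + q C (A.1 - C.1) - p A| ≤ e) :
    |massN μ φ β γ p q L t A - p A * massZ μ φ β γ p q L t A| ≤
      e * massZ μ φ β γ p q L t A := by
  have hN := integrableOn_param (A := A) (β := β) (γ := γ) (μ := μ)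
    (contDiff_kernelN hφ t).continuous hp hq hL
  have hZ := integrableOn_param (A := A) (β := β) (γ := γ) (μ := μ)
    (contDiff_kernelZ hφ t).continuous hp hq hL
  unfold massN massZ
  rw [← integral_const_mul, ← integral_const_mul, ← integral_sub hN (hZ.const_mul _),
    ← Real.norm_eq_abs]
  refine norm_integral_le_of_norm_le (hZ.const_mul _) ?_
  refine (ae_restrict_mem hL.measurableSet).mono fun C hC => ?_
  simp only [kernelN, ← sub_mul, norm_mul]
  by_cases hs : ‖shear (drift β γ p C) t (A - C)‖ ≤ 2
  · have h0 : 0 ≤ kernelZ φ t (kernelParam β γ p q C, A - C) := hφ0 _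
    rw [Real.norm_of_nonneg h0]
    exact mul_le_mul_of_nonneg_right (h C hC hs) (hφ0 _)
  · have : kernelZ φ t (kernelParam β γ p q C, A - C) = 0 := hφ2 _ (not_le.1 hs)
    simp [this]

theorem abs_fderiv_massN_sub_le (hφ : ContDiff ℝ 1 φ) (hφ0 : ∀ z, 0 ≤ φ z)
    (hφ2 : ∀ z, 2 < ‖z‖ → φ z = 0) (hM : ∀ z, ‖fderiv ℝ φ z‖ ≤ M)
    (hp : Continuous p) (hq : Continuous q) (hL : IsCompact L) (ht : 0 < t) {e d ε' : ℝ}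
    {f : E × F → ℝ} {S : Set (E × F)} (hS : MeasurableSet S)
    (h : ∀ C ∈ L, ‖shear (drift β γ p C) t (A - C)‖ ≤ 2 → C ∈ S ∧
      |p C + q C (A.1 - C.1) - f A| ≤ e ∧ ‖q C - q A‖ ≤ d ∧ |f A - p C| ≤ ε' * t)
    (hε' : 0 ≤ ε') (he : 0 ≤ e) (ξ : E) :
    |fderiv ℝ (massN μ φ β γ p q L t) A (ξ, drift β γ f A ξ) -
      f A * fderiv ℝ (massZ μ φ β γ p q L t) A (ξ, drift β γ f A ξ) -
      q A ξ * massZ μ φ β γ p q L t A| ≤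
      d * ‖ξ‖ * massZ μ φ β γ p q L t A +
        e * (M * ((1 + ε' * ‖β‖ + 2 * ‖γ‖) * t⁻¹ * ‖ξ‖)) * μ.real (S ∩ L) := by
  have hM0 : 0 ≤ M := (norm_nonneg _).trans (hM 0)
  have hZ := integrableOn_param (A := A) (β := β) (γ := γ) (μ := μ)
    (contDiff_kernelZ hφ t).continuous hp hq hL
  set v : E × F := (ξ, drift β γ f A ξ) with hv
  have hN' := integrableOn_param (A := A) (β := β) (γ := γ) (μ := μ)
    (((contDiff_kernelN hφ t).continuous_fderiv one_ne_zero).clm_apply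
      (continuous_const (y := ((0, v) : (ℝ × (E →L[ℝ] ℝ) × (E →L[ℝ] F)) × (E × F))))) hp hq hL
  have hZ' := integrableOn_param (A := A) (β := β) (γ := γ) (μ := μ)
    (((contDiff_kernelZ hφ t).continuous_fderiv one_ne_zero).clm_apply
      (continuous_const (y := ((0, v) : (ℝ × (E →L[ℝ] ℝ) × (E →L[ℝ] F)) × (E × F))))) hp hq hL
  have eN : fderiv ℝ (massN μ φ β γ p q L t) A v = _ :=
    fderiv_setIntegral_param_apply μ (contDiff_kernelN hφ t) (continuous_kernelParam hp hq) hL A v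
  have eZ : fderiv ℝ (massZ μ φ β γ p q L t) A v = _ :=
    fderiv_setIntegral_param_apply μ (contDiff_kernelZ hφ t) (continuous_kernelParam hp hq) hL A v
  have hNZ : IntegrableOn (fun C =>
      fderiv ℝ (kernelN φ t) (kernelParam β γ p q C, A - C) (0, v) -
        f A * fderiv ℝ (kernelZ φ t) (kernelParam β γ p q C, A - C) (0, v)) L μ :=
    hN'.sub (hZ'.const_mul _)
  have : IsFiniteMeasure (μ.restrict L) := ⟨by simpa using hL.measure_lt_top⟩
  rw [eN, eZ]
  unfold massZ
  rw [← integral_const_mul, ← integral_const_mul, ← integral_const_mul,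
    ← integral_sub hN' (hZ'.const_mul _), ← integral_sub hNZ (hZ.const_mul _),
    ← Real.norm_eq_abs]
  set c₁ := e * (M * ((1 + ε' * ‖β‖ + 2 * ‖γ‖) * t⁻¹ * ‖ξ‖)) with hc₁
  have hc₁0 : 0 ≤ c₁ := by positivity
  have hInd : ∫ C in L, S.indicator (fun _ => c₁) C ∂μ = c₁ * μ.real (S ∩ L) := by
    rw [integral_indicator_const _ hS, measureReal_restrict_apply hS, smul_eq_mul, mul_comm]
  rw [← hInd, ← integral_add (hZ.const_mul _) ((integrable_const _).indicator hS)]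
  refine norm_integral_le_of_norm_le
    ((hZ.const_mul _).add ((integrable_const _).indicator hS)) ?_
  refine (ae_restrict_mem hL.measurableSet).mono fun C hC => ?_
  rw [fderiv_kernelN hφ, fderiv_kernelZ hφ]
  simp only [kernelParam, kernelZ]
  by_cases hs : ‖shear (drift β γ p C) t (A - C)‖ ≤ 2
  · obtain ⟨hCS, h1, h2, h3⟩ := h C hC hs
    rw [indicator_of_mem hCS]
    have hx : ‖A.1 - C.1‖ ≤ 2 * t := by
      simpa using ((norm_shear_le_iff _ ht _ _).1 hs).1
    have h4 : ‖fderiv ℝ φ (shear (drift β γ p C) t (A - C)) (shear (drift β γ p C) t v)‖ ≤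
        M * ((1 + ε' * ‖β‖ + 2 * ‖γ‖) * t⁻¹ * ‖ξ‖) :=
      (ContinuousLinearMap.le_opNorm _ _).trans
        (mul_le_mul (hM _) (norm_shear_graph_le ht h3 hx ξ) (norm_nonneg _) hM0)
    have h5 : ‖(q C - q A) ξ‖ ≤ d * ‖ξ‖ := (ContinuousLinearMap.le_opNorm _ _).trans (by gcongr)
    have h6 := hφ0 (shear (drift β γ p C) t (A - C))
    set y := φ (shear (drift β γ p C) t (A - C))
    set y' := fderiv ℝ φ (shear (drift β γ p C) t (A - C)) (shear (drift β γ p C) t v)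
    have : q C v.1 * y + (p C + q C (A - C).1) * y' - f A * y' - q A ξ * y =
        (q C - q A) ξ * y + (p C + q C (A.1 - C.1) - f A) * y' := by
      simp [hv]
      ring
    rw [this]
    refine (norm_add_le _ _).trans (add_le_add ?_ ?_)
    · rw [norm_mul, Real.norm_of_nonneg h6]
      gcongr
    · rw [norm_mul]
      exact mul_le_mul h1 h4 (norm_nonneg _) he
  · have hs' := not_le.1 hs
    have hev : φ =ᶠ[𝓝 (shear (drift β γ p C) t (A - C))] fun _ => 0 :=
      (continuous_norm.continuousAt.eventually (lt_mem_nhds hs')).mono hφ2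
    rw [hφ2 _ hs', hev.fderiv_eq]
    simpa using indicator_nonneg (fun _ _ => hc₁0) C

/-- The normalized average at scale `t` of the Taylor polynomials of `p`. -/
def avg (μ : Measure (E × F)) (φ : E × F → ℝ) (β : E →L[ℝ] F) (γ : E →L[ℝ] E →L[ℝ] F)
    (p : E × F → ℝ) (q : E × F → E →L[ℝ] ℝ) (L : Set (E × F)) (t : ℝ) (A : E × F) : ℝ :=
  massN μ φ β γ p q L t A / massZ μ φ β γ p q L t A

set_option maxHeartbeats 1000000 in
theorem exists_nhds_avg_approx (hφ : ContDiff ℝ 1 φ) (hφ0 : ∀ z, 0 ≤ φ z)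
    (hφ1 : ∀ z, ‖z‖ ≤ 1 → φ z = 1) (hφ2 : ∀ z, 2 < ‖z‖ → φ z = 0)
    (hM : ∀ z, ‖fderiv ℝ φ z‖ ≤ M) (hp : Continuous p) (hq : Continuous q) (hL : IsCompact L)
    (hA₀ : L ∈ 𝓝 A₀) (hexp : ∀ ε > 0, ∃ r > 0, ExpandsOn β γ p (q A₀) A₀ ε r)
    {δ : ℝ} (hδ : 0 < δ) :
    ∃ U ∈ 𝓝 A₀, ∃ t₀ > 0, ∀ t, 0 < t → t < t₀ → ∀ A ∈ U,
      0 < massZ μ φ β γ p q L t A ∧ |avg μ φ β γ p q L t A - p A| ≤ δ ∧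
      ∀ ξ : E, |fderiv ℝ (massN μ φ β γ p q L t) A (ξ, drift β γ (avg μ φ β γ p q L t) A ξ) -
        avg μ φ β γ p q L t A *
          fderiv ℝ (massZ μ φ β γ p q L t) A (ξ, drift β γ (avg μ φ β γ p q L t) A ξ) -
        q A ξ * massZ μ φ β γ p q L t A| ≤ δ * ‖ξ‖ * massZ μ φ β γ p q L t A := by
  have hM0 : 0 ≤ M := (norm_nonneg _).trans (hM 0)
  set k := 2 * ‖q A₀‖ + 4 with hk
  have hk0 : 0 ≤ k := by positivity
  set κ := 1 + k * ‖β‖ + 2 * ‖γ‖ with hκ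
  have hκ1 : 1 ≤ κ := by
    have : 0 ≤ k * ‖β‖ + 2 * ‖γ‖ := by positivity
    linarith
  have hκ0 : 0 < κ := by linarith
  have hκi : κ⁻¹ ≤ 1 := inv_le_one_of_one_le₀ hκ1
  set D := (2 * κ / κ⁻¹) ^ Module.finrank ℝ (E × F) with hD
  set G := 1 + (6 + k) * ‖β‖ + 2 * ‖γ‖ with hG
  have hG0 : 0 ≤ G := by positivity
  have hD0 : 0 ≤ D := by positivity
  set ε := min 1 (δ / (6 + 12 * M * G * D)) with hεdef
  have hden : 0 < 6 + 12 * M * G * D := by positivity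
  have hε : 0 < ε := lt_min one_pos (div_pos hδ hden)
  have hε1 : ε ≤ 1 := min_le_left _ _
  have hεδ : ε * (6 + 12 * M * G * D) ≤ δ := by
    have := (le_div_iff₀ hden).1 (min_le_right 1 (δ / (6 + 12 * M * G * D)))
    exact this
  obtain ⟨r₁, hr₁, hE⟩ := hexp ε hε
  obtain ⟨r₂, hr₂, hq2⟩ := Metric.continuousAt_iff.1 hq.continuousAt ε hε
  obtain ⟨r₃, hr₃, hL3⟩ := Metric.mem_nhds_iff.1 hA₀
  obtain ⟨Ma, hMa⟩ := hL.exists_bound_of_continuousOn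
    (continuous_drift (β := β) (γ := γ) hp).continuousOn
  have hMa0 : 0 ≤ Ma := (norm_nonneg _).trans (hMa A₀ (mem_of_mem_nhds hA₀))
  set r := min r₁ (min r₂ r₃) with hr
  have hr0 : 0 < r := lt_min hr₁ (lt_min hr₂ hr₃)
  have hb1 : Metric.ball A₀ r ⊆ Metric.ball A₀ r₁ := Metric.ball_subset_ball (min_le_left _ _)
  have hb2 : ∀ C ∈ Metric.ball A₀ r, ‖q C - q A₀‖ ≤ ε := fun C hC => by
    rw [← dist_eq_norm]
    exact (hq2 ((Metric.mem_ball.1 hC).trans_le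
      ((min_le_right _ _).trans (min_le_left _ _)))).le
  have hb3 : Metric.ball A₀ r ⊆ L :=
    (Metric.ball_subset_ball ((min_le_right _ _).trans (min_le_right _ _))).trans hL3
  refine ⟨Metric.ball A₀ (r / 2), Metric.ball_mem_nhds _ (by positivity),
    min 1 (r / 2 / (2 + 2 * Ma)), by positivity, fun t ht htt A hA => ?_⟩
  have ht1 : t ≤ 1 := (htt.trans_le (min_le_left _ _)).le
  have htr : (2 + 2 * Ma) * t < r / 2 := by
    have := (lt_div_iff₀ (by positivity)).1 (htt.trans_le (min_le_right _ _))
    linarith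
  have hAr : A ∈ Metric.ball A₀ r := Metric.ball_subset_ball (by linarith) hA
  have hnear : ∀ {a : E →L[ℝ] F} {C : E × F}, ‖a‖ ≤ Ma → ‖shear a t (A - C)‖ ≤ 2 →
      C ∈ Metric.ball A₀ r := fun {a C} ha hs => by
    have h1 := norm_sub_le_of_shear ha ht ht1 hs
    rw [Metric.mem_ball] at hA ⊢
    have h2 := dist_triangle C A A₀
    rw [dist_comm C A, dist_eq_norm A C] at h2
    linarith
  have hupper : ∀ C ∈ L, ‖shear (drift β γ p C) t (A - C)‖ ≤ 2 →
      C ∈ Metric.ball A₀ r ∧ |p A - p C| ≤ k * t ∧ ‖A.1 - C.1‖ ≤ 2 * t ∧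
      |p C + q C (A.1 - C.1) - p A| ≤ 6 * ε * t := fun C hC hs => by
    have hCr := hnear (hMa C hC) hs
    have hx : ‖A.1 - C.1‖ ≤ 2 * t := by
      simpa using ((norm_shear_le_iff _ ht _ _).1 hs).1
    refine ⟨hCr, hE.abs_sub_le hε.le hε1 ht le_rfl (hb1 hCr) (hb1 hAr) hs, hx, ?_⟩
    have h1 := hE.abs_sub_sub_le hε.le ht le_rfl (hb1 hCr) (hb1 hAr) hs
    have h2 : ‖(q C - q A₀) (A.1 - C.1)‖ ≤ ε * (2 * t) :=
      (ContinuousLinearMap.le_opNorm _ _).trans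
        (mul_le_mul (hb2 C hCr) hx (norm_nonneg _) hε.le)
    have h3 : p C + q C (A.1 - C.1) - p A =
        (q C - q A₀) (A.1 - C.1) - (p A - p C - q A₀ (A.1 - C.1)) := by
      rw [sub_apply]
      ring
    rw [h3, ← Real.norm_eq_abs]
    refine (norm_sub_le _ _).trans ?_
    rw [Real.norm_eq_abs (p A - p C - q A₀ (A.1 - C.1))]
    linarith
  set S' := {C | ‖shear (drift β γ p A) t (A - C)‖ ≤ κ⁻¹} with hS'
  set S := {C | ‖shear (drift β γ p A) t (A - C)‖ ≤ 2 * κ} with hS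
  have hlower : ∀ C ∈ S', C ∈ L ∧ ‖shear (drift β γ p C) t (A - C)‖ ≤ 1 := fun C hC => by
    have hC' : ‖shear (drift β γ p A) t (A - C)‖ ≤ κ⁻¹ := hC
    have hC2 : ‖shear (drift β γ p A) t (A - C)‖ ≤ 2 := by linarith
    have hCr := hnear (hMa A (hb3 hAr)) hC2
    have hCA : ‖shear (drift β γ p A) t (C - A)‖ ≤ 2 := by
      rwa [← neg_sub, map_neg, norm_neg]
    have h1 := hE.abs_sub_le hε.le hε1 ht le_rfl (hb1 hAr) (hb1 hCr) hCA
    rw [abs_sub_comm] at h1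
    have hx : ‖A.1 - C.1‖ ≤ 2 * t := by
      simpa using ((norm_shear_le_iff _ ht _ _).1 hC2).1
    refine ⟨hb3 hCr, (norm_shear_drift_le ht h1 hx hC').trans_eq ?_⟩
    exact inv_mul_cancel₀ hκ0.ne'
  have hmeas : ∀ c : ℝ, MeasurableSet {C | ‖shear (drift β γ p A) t (A - C)‖ ≤ c} := fun c =>
    (isClosed_le (by fun_prop) continuous_const).measurableSet
  have hZ1 : μ.real S' ≤ massZ μ φ β γ p q L t A :=
    measureReal_shear_le_massZ hφ hφ0 hφ1 hp hq hL (hmeas _) hlower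
  have hS'0 : 0 < μ.real S' :=
    measureReal_shear_pos (inv_pos.2 hκ0) hL fun C hC => (hlower C hC).1
  have hZ0 := hS'0.trans_le hZ1
  have hSr : μ.real S = D * μ.real S' :=
    measureReal_shear_ratio μ _ A (inv_pos.2 hκ0) (by positivity)
  have hSfin : μ S ≠ ⊤ := fun h => by
    have : μ.real S = 0 := by simp [measureReal_def, h]
    have hDpos : 0 < D := by positivity
    nlinarith [mul_pos hDpos hS'0]
  have hSL : μ.real (S ∩ L) ≤ D * massZ μ φ β γ p q L t A :=
    (measureReal_mono inter_subset_left hSfin).trans (hSr.trans_le (by gcongr))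
  have hN := abs_massN_sub_le (μ := μ) hφ hφ0 hφ2 hp hq hL fun C hC hs => (hupper C hC hs).2.2.2
  have hf : |avg μ φ β γ p q L t A - p A| ≤ 6 * ε * t := by
    have : avg μ φ β γ p q L t A - p A =
        (massN μ φ β γ p q L t A - p A * massZ μ φ β γ p q L t A) /
          massZ μ φ β γ p q L t A := by
      unfold avg
      field_simp
    rw [this, abs_div, abs_of_pos hZ0, div_le_iff₀ hZ0]
    exact hN
  refine ⟨hZ0, hf.trans ?_, fun ξ => ?_⟩
  · have : 0 ≤ 12 * M * G * D := by positivity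
    nlinarith
  · have hyp : ∀ C ∈ L, ‖shear (drift β γ p C) t (A - C)‖ ≤ 2 → C ∈ S ∧
        |p C + q C (A.1 - C.1) - avg μ φ β γ p q L t A| ≤ 12 * ε * t ∧
        ‖q C - q A‖ ≤ 2 * ε ∧ |avg μ φ β γ p q L t A - p C| ≤ (6 + k) * t := by
      intro C hC hs
      obtain ⟨hCr, h1, hx, h2⟩ := hupper C hC hs
      refine ⟨?_, ?_, ?_, ?_⟩
      · exact (norm_shear_drift_le ht (by rwa [abs_sub_comm]) (by rwa [norm_sub_rev]) hs)
      · have := abs_sub_le (p C + q C (A.1 - C.1)) (p A) (avg μ φ β γ p q L t A)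
        rw [abs_sub_comm (p A)] at this
        linarith
      · have := norm_sub_le_norm_sub_add_norm_sub (q C) (q A₀) (q A)
        rw [norm_sub_rev (q A₀)] at this
        linarith [hb2 C hCr, hb2 A hAr]
      · have := abs_sub_le (avg μ φ β γ p q L t A) (p A) (p C)
        have h3 := mul_le_mul_of_nonneg_right hε1 ht.le
        linarith only [this, h3, hf, h1]
    refine (abs_fderiv_massN_sub_le (μ := μ) (f := avg μ φ β γ p q L t) hφ hφ0 hφ2 hM hp hq hL
      ht (hmeas _) hyp (by positivity) (by positivity) ξ).trans ?_
    have h1 : 12 * ε * t * (M * (G * t⁻¹ * ‖ξ‖)) * μ.real (S ∩ L) ≤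
        12 * ε * t * (M * (G * t⁻¹ * ‖ξ‖)) * (D * massZ μ φ β γ p q L t A) := by gcongr
    have h2 : 12 * ε * t * (M * (G * t⁻¹ * ‖ξ‖)) * (D * massZ μ φ β γ p q L t A) =
        ε * (12 * M * G * D) * (‖ξ‖ * massZ μ φ β γ p q L t A) := by
      field_simp
    have h3 : ε * (6 + 12 * M * G * D) * (‖ξ‖ * massZ μ φ β γ p q L t A) ≤
        δ * (‖ξ‖ * massZ μ φ β γ p q L t A) := by gcongr
    have h4 : 0 ≤ ε * (‖ξ‖ * massZ μ φ β γ p q L t A) := by positivity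
    linarith

theorem exists_forall_of_locally {X : Type*} [TopologicalSpace X] {K : Set X} (hK : IsCompact K)
    {P : ℝ → X → Prop}
    (h : ∀ x ∈ K, ∃ U ∈ 𝓝 x, ∃ t₀ > 0, ∀ t, 0 < t → t < t₀ → ∀ y ∈ U, P t y) :
    ∃ t₀ > 0, ∀ t, 0 < t → t < t₀ → ∀ y ∈ K, P t y := by
  refine hK.induction_on (p := fun S => ∃ t₀ > 0, ∀ t, 0 < t → t < t₀ → ∀ y ∈ S, P t y)
    ⟨1, one_pos, fun t _ _ y hy => hy.elim⟩ ?_ ?_ ?_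
  · rintro S T hST ⟨t₀, h0, h⟩
    exact ⟨t₀, h0, fun t ht htt y hy => h t ht htt y (hST hy)⟩
  · rintro S T ⟨t₀, h0, h⟩ ⟨t₁, h0', h'⟩
    refine ⟨min t₀ t₁, lt_min h0 h0', fun t ht htt y hy => hy.elim (fun hy => ?_) fun hy => ?_⟩
    · exact h t ht (htt.trans_le (min_le_left _ _)) y hy
    · exact h' t ht (htt.trans_le (min_le_right _ _)) y hy
  · intro x hx
    obtain ⟨U, hU, h⟩ := h x hx
    exact ⟨U, mem_nhdsWithin_of_mem_nhds hU, h⟩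

theorem contDiff_massZ (hφ : ContDiff ℝ 1 φ) (hp : Continuous p) (hq : Continuous q)
    (hL : IsCompact L) : ContDiff ℝ 1 (massZ μ φ β γ p q L t) :=
  contDiff_setIntegral_param μ (contDiff_kernelZ hφ t) (continuous_kernelParam hp hq) hL

theorem contDiff_massN (hφ : ContDiff ℝ 1 φ) (hp : Continuous p) (hq : Continuous q)
    (hL : IsCompact L) : ContDiff ℝ 1 (massN μ φ β γ p q L t) :=
  contDiff_setIntegral_param μ (contDiff_kernelN hφ t) (continuous_kernelParam hp hq) hL

/-- A function that admits, locally uniformly, first order expansions relative to its own graph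
quasi-distance is approximated on compact sets by `C¹` functions whose derivatives along their own
drift approximate its differential. -/
theorem exists_contDiff_approx {O : Set (E × F)} (hO : IsOpen O) {ψ : E × F → ℝ}
    {w : E × F → E →L[ℝ] ℝ} (hψ : ContinuousOn ψ O) (hw : ContinuousOn w O)
    (hexp : ∀ A₀ ∈ O, ∀ ε > 0, ∃ r > 0, ExpandsOn β γ ψ (w A₀) A₀ ε r) {K : Set (E × F)}
    (hK : IsCompact K) (hKO : K ⊆ O) {δ : ℝ} (hδ : 0 < δ) :
    ∃ f : E × F → ℝ, ContDiff ℝ 1 f ∧ ∀ A ∈ K, |f A - ψ A| ≤ δ ∧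
      ∀ ξ : E, |fderiv ℝ f A (ξ, drift β γ f A ξ) - w A ξ| ≤ δ * ‖ξ‖ := by
  obtain ⟨L, hL, hKL, hLO⟩ := exists_compact_between hK hO hKO
  obtain ⟨K₁, hK₁, hKK₁, hK₁L⟩ := exists_compact_between hK isOpen_interior hKL
  obtain ⟨p, hpψ⟩ := ContinuousMap.exists_restrict_eq hL.isClosed
    ⟨L.domRestrict ψ, continuousOn_iff_continuous_domRestrict.1 (hψ.mono hLO)⟩
  obtain ⟨q, hqw⟩ := ContinuousMap.exists_restrict_eq hL.isClosed
    ⟨L.domRestrict w, continuousOn_iff_continuous_domRestrict.1 (hw.mono hLO)⟩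
  replace hpψ : ∀ A ∈ L, p A = ψ A := fun A hA => DFunLike.congr_fun hpψ ⟨A, hA⟩
  replace hqw : ∀ A ∈ L, q A = w A := fun A hA => DFunLike.congr_fun hqw ⟨A, hA⟩
  obtain ⟨φ, hφ, hφ0, hφ1, hφ2, M, hM⟩ : ∃ φ : E × F → ℝ, ContDiff ℝ 1 φ ∧ (∀ z, 0 ≤ φ z) ∧
      (∀ z, ‖z‖ ≤ 1 → φ z = 1) ∧ (∀ z, 2 < ‖z‖ → φ z = 0) ∧ ∃ M, ∀ z, ‖fderiv ℝ φ z‖ ≤ M := by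
    obtain ⟨φ, hφ⟩ := exists_contMDiff_zero_iff_one_iff_of_isClosed (n := 1)
      (modelWithCornersSelf ℝ (E × F)) (s := {z : E × F | 2 ≤ ‖z‖}) (t := {z | ‖z‖ ≤ 1})
      (isClosed_le continuous_const continuous_norm) (isClosed_le continuous_norm continuous_const)
      (Set.disjoint_left.2 fun z (h1 : 2 ≤ ‖z‖) (h2 : ‖z‖ ≤ 1) => by linarith)
    obtain ⟨h1, h2, h3, h4⟩ := hφ
    have h1' : ContDiff ℝ 1 φ := h1.contDiff
    have h5 : HasCompactSupport φ := HasCompactSupport.of_support_subset_isCompact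
      (isCompact_closedBall (0 : E × F) 2) fun z hz => by
        rw [mem_closedBall_zero_iff]
        by_contra! h
        exact hz ((h3 z).1 h.le)
    refine ⟨φ, h1', fun z => (h2 ⟨z, rfl⟩).1, fun z hz => (h4 z).1 hz,
      fun z hz => (h3 z).1 hz.le, ?_⟩
    exact (h5.fderiv ℝ).exists_bound_of_continuous (h1'.continuous_fderiv one_ne_zero)
  obtain ⟨χ, hχ1, hχ0, hχI⟩ := exists_contMDiffMap_one_nhds_of_subset_interior (n := 1)
    (modelWithCornersSelf ℝ (E × F)) hK.isClosed hKK₁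
  have hχ : ContDiff ℝ 1 χ := χ.contMDiff.contDiff
  set μ : Measure (E × F) := Measure.addHaar with hμ
  have hunif : ∃ t₀ > 0, ∀ t, 0 < t → t < t₀ → ∀ A ∈ K₁,
      0 < massZ μ φ β γ p q L t A ∧ |avg μ φ β γ p q L t A - p A| ≤ δ ∧
      ∀ ξ : E, |fderiv ℝ (massN μ φ β γ p q L t) A (ξ, drift β γ (avg μ φ β γ p q L t) A ξ) -
        avg μ φ β γ p q L t A *
          fderiv ℝ (massZ μ φ β γ p q L t) A (ξ, drift β γ (avg μ φ β γ p q L t) A ξ) -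
        q A ξ * massZ μ φ β γ p q L t A| ≤ δ * ‖ξ‖ * massZ μ φ β γ p q L t A := by
    refine exists_forall_of_locally hK₁ fun A₀ hA₀ => ?_
    have hLA : L ∈ 𝓝 A₀ := mem_interior_iff_mem_nhds.1 (hK₁L hA₀)
    have hA₀L := mem_of_mem_nhds hLA
    have hexp' : ∀ ε > 0, ∃ r > 0, ExpandsOn β γ p (q A₀) A₀ ε r := by
      intro ε hε
      obtain ⟨r, hr, h⟩ := hexp A₀ (hLO hA₀L) ε hε
      obtain ⟨r', hr', hrL⟩ := Metric.mem_nhds_iff.1 hLA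
      refine ⟨min r r', lt_min hr hr', fun A hA B hB => ?_⟩
      have hAL := hrL (Metric.ball_subset_ball (min_le_right _ _) hA)
      have hBL := hrL (Metric.ball_subset_ball (min_le_right _ _) hB)
      have h1 := h A (Metric.ball_subset_ball (min_le_left _ _) hA) B
        (Metric.ball_subset_ball (min_le_left _ _) hB)
      simpa only [drift, hpψ A hAL, hpψ B hBL, hqw A₀ hA₀L] using h1
    obtain ⟨U, hU, t₀, h0, h⟩ := exists_nhds_avg_approx (μ := μ) hφ hφ0 hφ1 hφ2 hM p.continuous
      q.continuous hL hLA hexp' hδ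
    exact ⟨U, hU, t₀, h0, h⟩
  obtain ⟨t₀, ht₀, hunif⟩ := hunif
  obtain ⟨t, ht, htt⟩ := exists_between ht₀
  replace hunif := hunif t ht htt
  have hN : ContDiff ℝ 1 (massN μ φ β γ p q L t) :=
    contDiff_massN hφ p.continuous q.continuous hL
  have hZ : ContDiff ℝ 1 (massZ μ φ β γ p q L t) :=
    contDiff_massZ hφ p.continuous q.continuous hL
  have hden : ∀ A, massZ μ φ β γ p q L t A + (1 - χ A) ≠ 0 := fun A => by
    refine ne_of_gt ?_
    by_cases hA : A ∈ K₁
    · linarith [(hunif A hA).1, (hχI A).2]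
    · have : 0 ≤ massZ μ φ β γ p q L t A := integral_nonneg fun C => hφ0 _
      rw [hχ0 A hA]
      linarith
  refine ⟨fun A => massN μ φ β γ p q L t A / (massZ μ φ β γ p q L t A + (1 - χ A)),
    hN.div (hZ.add (contDiff_const.sub hχ)) hden, fun A hA => ?_⟩
  have hev : (fun A => massN μ φ β γ p q L t A / (massZ μ φ β γ p q L t A + (1 - χ A))) =ᶠ[𝓝 A]
      avg μ φ β γ p q L t := by
    filter_upwards [hχ1.filter_mono (nhds_le_nhdsSet hA)] with B hB
    rw [hB, sub_self, add_zero, avg]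
  have hAK₁ := interior_subset (hKK₁ hA)
  have hAL := interior_subset (hK₁L hAK₁)
  obtain ⟨h1, h2, h3⟩ := hunif A hAK₁
  rw [hev.fderiv_eq, ← hpψ A hAL]
  simp only [hev.eq_of_nhds, drift] at h3 ⊢
  refine ⟨h2, fun ξ => ?_⟩
  specialize h3 ξ
  have hZA := hZ.differentiable one_ne_zero A
  have havg : DifferentiableAt ℝ (avg μ φ β γ p q L t) A :=
    (hN.contDiffAt.div hZ.contDiffAt h1.ne').differentiableAt one_ne_zero
  have hmul : massN μ φ β γ p q L t =ᶠ[𝓝 A]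
      fun B => avg μ φ β γ p q L t B * massZ μ φ β γ p q L t B := by
    filter_upwards [hZ.continuous.continuousAt.eventually_ne h1.ne'] with B hB
    rw [avg, div_mul_cancel₀ _ hB]
  rw [hmul.fderiv_eq, fderiv_fun_mul havg hZA, hqw A hAL] at h3
  simp only [add_apply, smul_apply, smul_eq_mul, add_sub_cancel_left] at h3 ⊢
  rw [mul_comm (w A ξ), ← mul_sub, abs_mul, abs_of_pos h1, mul_comm] at h3
  exact le_of_mul_le_mul_right h3 h1

end Approximation

theorem tendsto_setIntegral_comp {X : Type*} [TopologicalSpace X] [T2Space X] [MeasurableSpace X]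
    [OpensMeasurableSpace X] {μ : Measure X} [IsFiniteMeasureOnCompacts μ] {K : Set X}
    (hK : IsCompact K) {Φ : X × ℝ → ℝ} (hΦ : Continuous Φ) {f : ℕ → X → ℝ} {g : X → ℝ}
    (hf : ∀ k, ContinuousOn (f k) K) (hfg : TendstoUniformlyOn f g atTop K) :
    Tendsto (fun k => ∫ A in K, Φ (A, f k A) ∂μ) atTop (𝓝 (∫ A in K, Φ (A, g A) ∂μ)) := by
  have hg : ContinuousOn g K := hfg.continuousOn (Frequently.of_forall hf)
  obtain ⟨M, hM⟩ := hK.exists_bound_of_continuousOn hg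
  obtain ⟨C, hC⟩ := (hK.prod (isCompact_closedBall (0 : ℝ) (M + 1))).exists_bound_of_continuousOn
    hΦ.continuousOn
  have : IsFiniteMeasure (μ.restrict K) := ⟨by simpa using hK.measure_lt_top⟩
  refine tendsto_integral_filter_of_dominated_convergence (fun _ => C) ?_ ?_
    (integrable_const _) ?_
  · exact Eventually.of_forall fun k =>
      (hΦ.comp_continuousOn (continuousOn_id.prodMk (hf k))).aestronglyMeasurable_of_isCompact
        hK hK.measurableSet
  · filter_upwards [Metric.tendstoUniformlyOn_iff.1 hfg 1 one_pos] with k hk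
    refine (ae_restrict_mem hK.measurableSet).mono fun A hA => hC _ ⟨hA, ?_⟩
    rw [mem_closedBall_zero_iff]
    have h1 := hk A hA
    rw [dist_comm, dist_eq_norm] at h1
    have h2 := norm_add_le (f k A - g A) (g A)
    rw [sub_add_cancel] at h2
    linarith [hM A hA]
  · refine (ae_restrict_mem hK.measurableSet).mono fun A hA => ?_
    exact (hΦ.tendsto (A, g A)).comp (tendsto_const_nhds.prodMk_nhds (hfg.tendsto_at hA))

section IntegrationByParts

variable {E F : Type*} [NormedAddCommGroup E] [NormedSpace ℝ E] [FiniteDimensional ℝ E]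
  [MeasurableSpace E] [BorelSpace E] [NormedAddCommGroup F] [NormedSpace ℝ F]
  [FiniteDimensional ℝ F] [MeasurableSpace F] [BorelSpace F]

theorem integral_mul_fderiv_eq_neg (μ : Measure E) [μ.IsAddHaarMeasure] {f η : E → ℝ}
    (hf : ContDiff ℝ 1 f) (hη : ContDiff ℝ 1 η) (hηc : HasCompactSupport η) (v : E) :
    ∫ A, f A * fderiv ℝ η A v ∂μ = -∫ A, fderiv ℝ f A v * η A ∂μ := by
  have hη' : Continuous fun A => fderiv ℝ η A v :=
    (hη.continuous_fderiv one_ne_zero).clm_apply continuous_const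
  have hf' : Continuous fun A => fderiv ℝ f A v :=
    (hf.continuous_fderiv one_ne_zero).clm_apply continuous_const
  exact integral_mul_fderiv_eq_neg_fderiv_mul_of_integrable
    ((hf'.mul hη.continuous).integrable_of_hasCompactSupport hηc.mul_left)
    ((hf.continuous.mul hη').integrable_of_hasCompactSupport (hηc.fderiv_apply ℝ v).mul_left)
    ((hf.continuous.mul hη.continuous).integrable_of_hasCompactSupport hηc.mul_left)
    (fun A _ => hf.differentiable one_ne_zero A) fun A _ => hη.differentiable one_ne_zero A

theorem integral_burgers_mul_fderiv_eq_neg (μ : Measure (E × F)) [μ.IsAddHaarMeasure]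
    {f η : E × F → ℝ} (hf : ContDiff ℝ 1 f) (hη : ContDiff ℝ 1 η) (hηc : HasCompactSupport η)
    (κ : ℝ) (ℓ : E →L[ℝ] ℝ) (y : F) :
    ∫ A, ((1 / 2) * f A ^ 2 * κ + ℓ A.1 * f A) * fderiv ℝ η A (0, y) ∂μ =
      -∫ A, (f A * κ + ℓ A.1) * fderiv ℝ f A (0, y) * η A ∂μ := by
  have hF : ContDiff ℝ 1 fun A => (1 / 2) * f A ^ 2 * κ + ℓ A.1 * f A := by fun_prop
  rw [integral_mul_fderiv_eq_neg μ hF hη hηc]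
  congr 2 with A
  congr 1
  have h := (hf.differentiable one_ne_zero A).hasFDerivAt
  have hℓ : HasFDerivAt (fun A : E × F => ℓ A.1) (ℓ.comp (ContinuousLinearMap.fst ℝ E F)) A :=
    (ℓ.comp (ContinuousLinearMap.fst ℝ E F)).hasFDerivAt
  have h2 := (((h.pow 2).const_mul (1 / 2 : ℝ)).mul_const κ).add (hℓ.mul h)
  have h3 : fderiv ℝ (fun A => (1 / 2) * f A ^ 2 * κ + ℓ A.1 * f A) A = _ := h2.fderiv
  rw [h3]
  simp
  ring

end IntegrationByParts

theorem sum_fin_eq_add {m : ℕ} (h0 : 0 < m) (g : Fin m → ℝ) :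
    ∑ i, g i = g ⟨0, h0⟩ + ∑ i, g (idx1 m i) := by
  cases m with
  | zero => exact absurd h0 (lt_irrefl 0)
  | succ m => exact Fin.sum_univ_succ g

theorem gmul_snd {m n : ℕ} (b : Fin n → Matrix (Fin m) (Fin m) ℝ) (P Q : G m n) :
    (gmul b P Q).2 = P.2 + Q.2 + fun s => (1 / 2) * (Q.1 ⬝ᵥ (b s).mulVec P.1) := by
  funext s
  simp only [gmul, Pi.add_apply, dotProduct, Matrix.mulVec, Finset.mul_sum]
  congr 1
  refine Finset.sum_congr rfl fun i _ => Finset.sum_congr rfl fun j _ => ?_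
  ring

theorem dotProduct_mulVec_skew {m : ℕ} {M : Matrix (Fin m) (Fin m) ℝ} (hM : M.transpose = -M)
    (u v : Fin m → ℝ) : u ⬝ᵥ M.mulVec v = -(v ⬝ᵥ M.mulVec u) := by
  rw [Matrix.dotProduct_mulVec, ← Matrix.mulVec_transpose, hM, dotProduct_comm, Matrix.neg_mulVec,
    dotProduct_neg]

/-- The linear part in `ψ` of the coefficients of the intrinsic derivatives. -/
def driftβ (m n : ℕ) (h0 : 0 < m) (b : Fin n → Matrix (Fin m) (Fin m) ℝ) :
    (Fin (m - 1) → ℝ) →L[ℝ] (Fin n → ℝ) :=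
  ContinuousLinearMap.pi fun s =>
    ∑ j, b s (idx1 m j) ⟨0, h0⟩ • ContinuousLinearMap.proj (R := ℝ) (φ := fun _ => ℝ) j

/-- The part linear in `x` of the coefficients of the intrinsic derivatives. -/
def driftγ (m n : ℕ) (b : Fin n → Matrix (Fin m) (Fin m) ℝ) :
    (Fin (m - 1) → ℝ) →L[ℝ] (Fin (m - 1) → ℝ) →L[ℝ] (Fin n → ℝ) :=
  ∑ l, ((ContinuousLinearMap.proj (R := ℝ) (φ := fun _ : Fin (m - 1) => ℝ) l).smulRight
    (ContinuousLinearMap.pi fun s => ∑ j, ((1 / 2) * b s (idx1 m j) (idx1 m l)) •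
      ContinuousLinearMap.proj (R := ℝ) (φ := fun _ : Fin (m - 1) => ℝ) j))

theorem driftβ_apply {m n : ℕ} (h0 : 0 < m) (b : Fin n → Matrix (Fin m) (Fin m) ℝ)
    (ξ : Fin (m - 1) → ℝ) (s : Fin n) :
    driftβ m n h0 b ξ s = ∑ j, ξ j * b s (idx1 m j) ⟨0, h0⟩ := by
  simp [driftβ, sum_apply, mul_comm]

theorem driftγ_apply {m n : ℕ} (b : Fin n → Matrix (Fin m) (Fin m) ℝ)
    (x ξ : Fin (m - 1) → ℝ) (s : Fin n) :
    driftγ m n b x ξ s =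
      ∑ j, ξ j * ((1 / 2) * ∑ l, x l * b s (idx1 m j) (idx1 m l)) := by
  simp only [driftγ, sum_apply, ContinuousLinearMap.smulRight_apply, ContinuousLinearMap.proj_apply,
    smul_apply, Finset.sum_apply, Pi.smul_apply, ContinuousLinearMap.pi_apply, smul_eq_mul,
    Finset.mul_sum]
  rw [Finset.sum_comm]
  refine Finset.sum_congr rfl fun i _ => Finset.sum_congr rfl fun j _ => ?_
  ring

theorem drift_apply {m n : ℕ} (h0 : 0 < m) (b : Fin n → Matrix (Fin m) (Fin m) ℝ)
    (p : W m n 1 → ℝ) (A : W m n 1) (ξ : Fin (m - 1) → ℝ) (s : Fin n) :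
    drift (driftβ m n h0 b) (driftγ m n b) p A ξ s =
      ∑ j, ξ j * (p A * b s (idx1 m j) ⟨0, h0⟩ +
        (1 / 2) * ∑ l, A.1 l * b s (idx1 m j) (idx1 m l)) := by
  simp only [drift, add_apply, smul_apply, Pi.add_apply, Pi.smul_apply, driftβ_apply,
    driftγ_apply, smul_eq_mul, mul_add, Finset.sum_add_distrib]
  congr 1
  rw [Finset.mul_sum]
  exact Finset.sum_congr rfl fun j _ => by ring

theorem embW_zero {m n : ℕ} (h0 : 0 < m) (A : W m n 1) : (embW m n 1 A).1 ⟨0, h0⟩ = 0 := by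
  simp [embW]

theorem embW_idx1 {m n : ℕ} (A : W m n 1) (j : Fin (m - 1)) :
    (embW m n 1 A).1 (idx1 m j) = A.1 j := by
  simp [embW, idx1]

theorem embH_zero {m n : ℕ} (h0 : 0 < m) (v : Fin 1 → ℝ) :
    (embH m n 1 v).1 ⟨0, h0⟩ = v 0 := by
  simp [embH]

theorem embH_idx1 {m n : ℕ} (v : Fin 1 → ℝ) (j : Fin (m - 1)) :
    (embH m n 1 v).1 (idx1 m j) = 0 := by
  simp [embH, idx1]

theorem sigma_eq {m n : ℕ} (h0 : 0 < m) (b : Fin n → Matrix (Fin m) (Fin m) ℝ)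
    (hskew : ∀ s, (b s).transpose = -(b s)) (p : W m n 1 → ℝ) (A B : W m n 1) :
    sigma m n 1 b (fun A' _ => p A') A B = enorm (B.1 - A.1) +
      √(enorm (B.2 - A.2 - drift (driftβ m n h0 b) (driftγ m n b) p A (B.1 - A.1))) := by
  have h1 : (gmul b (gmul b (gmul b (ginv (embH m n 1 fun _ => p A)) (ginv (embW m n 1 A)))
      (embW m n 1 B)) (embH m n 1 fun _ => p A)).1 = (embW m n 1 B).1 - (embW m n 1 A).1 := by
    simp only [gmul, ginv]
    abel
  have h2 : (gmul b (gmul b (gmul b (ginv (embH m n 1 fun _ => p A)) (ginv (embW m n 1 A)))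
      (embW m n 1 B)) (embH m n 1 fun _ => p A)).2 =
      B.2 - A.2 - drift (driftβ m n h0 b) (driftγ m n b) p A (B.1 - A.1) := by
    have hd : ∀ s, drift (driftβ m n h0 b) (driftγ m n b) p A (B.1 - A.1) s =
        ((embW m n 1 B).1 - (embW m n 1 A).1) ⬝ᵥ (b s).mulVec (embH m n 1 fun _ => p A).1 +
        (1 / 2) * (((embW m n 1 B).1 - (embW m n 1 A).1) ⬝ᵥ (b s).mulVec (embW m n 1 A).1) := by
      intro s
      rw [drift_apply, dotProduct, dotProduct, sum_fin_eq_add h0, sum_fin_eq_add h0]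
      simp only [Matrix.mulVec, dotProduct, sum_fin_eq_add h0 fun j => b s _ j * _, Pi.sub_apply,
        embW_zero, embW_idx1, embH_zero, embH_idx1]
      simp only [sub_self, zero_mul, zero_add, mul_zero, Finset.sum_const_zero, add_zero, mul_add,
        Finset.sum_add_distrib, Finset.mul_sum]
      congr 1
      · exact Finset.sum_congr rfl fun j _ => by ring
      · exact Finset.sum_congr rfl fun j _ => Finset.sum_congr rfl fun l _ => by ring
    funext s
    simp only [gmul_snd, Pi.add_apply, Pi.sub_apply, hd]
    have e1 : ∀ A : W m n 1, (embW m n 1 A).2 = A.2 := fun _ => rfl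
    have e2 : (embH m n 1 fun _ => p A).2 = 0 := rfl
    have e3 : ∀ P Q : G m n, (gmul b P Q).1 = P.1 + Q.1 := fun _ _ => rfl
    simp only [e3, ginv, e1, e2]
    generalize (embW m n 1 A).1 = x
    generalize (embW m n 1 B).1 = x'
    generalize (embH m n 1 fun _ => p A).1 = v
    have s1 := dotProduct_mulVec_skew (hskew s) v x
    have s2 := dotProduct_mulVec_skew (hskew s) v x'
    have s3 := dotProduct_mulVec_skew (hskew s) v v
    have s4 := dotProduct_mulVec_skew (hskew s) x x
    simp only [Matrix.mulVec_add, Matrix.mulVec_neg, dotProduct_add, dotProduct_neg, sub_dotProduct,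
      neg_dotProduct, Pi.neg_apply, Pi.zero_apply]
    linarith
  rw [sigma, qnorm, h1, h2]
  congr 1
  rw [enorm, enorm, sum_fin_eq_add h0]
  simp [embW_zero, embW_idx1]

theorem dW_eq_sigma {m n : ℕ} (b : Fin n → Matrix (Fin m) (Fin m) ℝ) (A B : W m n 1) :
    dW m n 1 b A B = sigma m n 1 b (fun _ _ => 0) A B := by
  have h : embH m n 1 (fun _ => 0) = 0 := by
    ext <;> simp [embH]
  simp only [dW, sigma, h]
  congr 1
  simp [gmul, ginv]

theorem enorm_nonneg {d : ℕ} (x : Fin d → ℝ) : 0 ≤ enorm x := Real.sqrt_nonneg _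

theorem eq_zero_of_enorm_eq_zero {d : ℕ} {x : Fin d → ℝ} (h : enorm x = 0) : x = 0 := by
  have h1 := (Real.sqrt_eq_zero (Finset.sum_nonneg fun i _ => sq_nonneg (x i))).1 h
  funext i
  exact pow_eq_zero_iff two_ne_zero |>.1
    ((Finset.sum_eq_zero_iff_of_nonneg fun i _ => sq_nonneg (x i)).1 h1 i (Finset.mem_univ i))

theorem continuous_enorm (d : ℕ) : Continuous (enorm : (Fin d → ℝ) → ℝ) := by
  unfold enorm
  fun_prop

theorem enorm_le {d : ℕ} (x : Fin d → ℝ) : enorm x ≤ (d + 1) * ‖x‖ := by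
  refine Real.sqrt_le_iff.2 ⟨by positivity, ?_⟩
  have h1 : ∑ i, x i ^ 2 ≤ ∑ _i : Fin d, ‖x‖ ^ 2 := Finset.sum_le_sum fun i _ => by
    rw [← sq_abs]
    gcongr
    exact norm_le_pi_norm x i
  rw [Finset.sum_const, Finset.card_univ, Fintype.card_fin, nsmul_eq_mul] at h1
  have : 0 ≤ (d : ℝ) * ‖x‖ ^ 2 := by positivity
  have : 0 ≤ ((d : ℝ) ^ 2 + 1) * ‖x‖ ^ 2 := by positivity
  nlinarith

theorem expandsOn_of_UIDs {m n : ℕ} (h0 : 0 < m) {b : Fin n → Matrix (Fin m) (Fin m) ℝ}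
    (hskew : ∀ s, (b s).transpose = -(b s)) {O : Set (W m n 1)} (hO : IsOpen O)
    {ψ : W m n 1 → ℝ} {A₀ : W m n 1} (hA₀ : A₀ ∈ O) {g : Fin (m - 1) → ℝ}
    (h : UIDs m n b O ψ A₀ g) {ε : ℝ} (hε : 0 < ε) :
    ∃ r > 0, ExpandsOn (driftβ m n h0 b) (driftγ m n b) ψ
      (∑ i, g i • ContinuousLinearMap.proj (R := ℝ) (φ := fun _ => ℝ) i) A₀ ε r := by
  obtain ⟨r, hr, h⟩ := h (ε / (m + n + 1)) (by positivity)
  have hdW : Continuous fun Q : W m n 1 × W m n 1 => dW m n 1 b Q.1 Q.2 := by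
    simp only [dW_eq_sigma, sigma_eq h0 b hskew (fun _ => 0), drift]
    have := continuous_enorm (m - 1)
    have := continuous_enorm n
    fun_prop
  have hdW0 : ∀ A, dW m n 1 b A A = 0 := fun A => by
    simp [dW_eq_sigma, sigma_eq h0 b hskew (fun _ => 0), enorm]
  have hev : ∀ᶠ Q : W m n 1 × W m n 1 in 𝓝 (A₀, A₀), Q.1 ∈ O ∧ Q.2 ∈ O ∧
      dW m n 1 b A₀ Q.1 < r ∧ dW m n 1 b Q.1 Q.2 < r := by
    refine (continuous_fst.continuousAt.eventually_mem (hO.mem_nhds hA₀)).and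
      ((continuous_snd.continuousAt.eventually_mem (hO.mem_nhds hA₀)).and (.and ?_ ?_))
    · refine (hdW.comp (continuous_const.prodMk continuous_fst)).continuousAt.eventually_lt
        continuousAt_const ?_
      simpa [hdW0] using hr
    · refine hdW.continuousAt.eventually_lt continuousAt_const ?_
      simpa [hdW0] using hr
  obtain ⟨r', hr', hball⟩ := Metric.eventually_nhds_iff_ball.1 hev
  refine ⟨r', hr', fun A hA B hB => ?_⟩
  obtain ⟨hAO, hBO, hA0, hAB⟩ := hball (A, B) (by
    rw [Metric.mem_ball, Prod.dist_eq]
    exact max_lt hA hB)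
  have hsum : (∑ i, g i • ContinuousLinearMap.proj (R := ℝ) (φ := fun _ => ℝ) i :
      (Fin (m - 1) → ℝ) →L[ℝ] ℝ) (B.1 - A.1) = ∑ i, g i * (B.1 i - A.1 i) := by
    simp [sum_apply]
  rw [hsum]
  have hnn : 0 ≤ dW m n 1 b A B := by
    rw [dW, qnorm]
    exact add_nonneg (enorm_nonneg _) (Real.sqrt_nonneg _)
  rcases hnn.eq_or_lt with h1 | h1
  · have hAB' : B = A := by
      rw [dW_eq_sigma, sigma_eq h0 b hskew (fun _ => 0), eq_comm,
        add_eq_zero_iff_of_nonneg (enorm_nonneg _) (Real.sqrt_nonneg _)] at h1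
      have h2 := eq_zero_of_enorm_eq_zero h1.1
      have h3 := eq_zero_of_enorm_eq_zero ((Real.sqrt_eq_zero (enorm_nonneg _)).1 h1.2)
      rw [h2, map_zero, sub_zero] at h3
      exact Prod.ext (sub_eq_zero.1 h2) (sub_eq_zero.1 h3)
    subst hAB'
    simp
  · refine (h A hAO B hBO hA0 hAB h1).trans ?_
    rw [sigma_eq h0 b hskew]
    set u := B.1 - A.1
    set v := B.2 - A.2 - drift (driftβ m n h0 b) (driftγ m n b) ψ A u
    have h2 : enorm u ≤ (m + n + 1) * ‖u‖ := (enorm_le u).trans (by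
      gcongr
      have : ((m - 1 : ℕ) : ℝ) ≤ m := by exact_mod_cast Nat.sub_le m 1
      linarith [(Nat.cast_nonneg n : (0 : ℝ) ≤ n)])
    have h3 : √(enorm v) ≤ (m + n + 1) * √‖v‖ := by
      refine Real.sqrt_le_iff.2 ⟨by positivity, ?_⟩
      rw [mul_pow, Real.sq_sqrt (norm_nonneg _)]
      refine (enorm_le v).trans ?_
      gcongr
      have h4 : (0 : ℝ) ≤ n := Nat.cast_nonneg n
      have h5 : (0 : ℝ) ≤ m := Nat.cast_nonneg m
      nlinarith [mul_nonneg h4 h5]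
    calc _ ≤ ε / (m + n + 1) * ((m + n + 1) * ‖u‖ + (m + n + 1) * √‖v‖) := by gcongr
      _ = ε * (‖u‖ + √‖v‖) := by field_simp

theorem Dj_eq {m n : ℕ} (h0 : 0 < m) (b : Fin n → Matrix (Fin m) (Fin m) ℝ)
    (ψ : W m n 1 → ℝ) (j : Fin (m - 1)) (A : W m n 1) :
    Dj m n h0 b ψ j A = fderiv ℝ ψ A (Pi.single j 1,
      drift (driftβ m n h0 b) (driftγ m n b) ψ A (Pi.single j 1)) := by
  have h1 : ((Pi.single j 1, drift (driftβ m n h0 b) (driftγ m n b) ψ A (Pi.single j 1)) :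
      W m n 1) = (Pi.single j 1, 0) + ∑ s, (ψ A * b s (idx1 m j) ⟨0, h0⟩ +
        (1 / 2) * ∑ l, A.1 l * b s (idx1 m j) (idx1 m l)) •
          ((0, Pi.single s 1) : W m n 1) := by
    ext s
    · simp [Prod.fst_sum]
    · simp [drift_apply, Pi.single_apply, Prod.snd_sum]
  rw [h1, map_add, map_sum]
  simp only [map_smul, smul_eq_mul, Dj]

theorem exists_seq_approx {m n : ℕ} (h0 : 0 < m) {b : Fin n → Matrix (Fin m) (Fin m) ℝ}
    (hskew : ∀ s, (b s).transpose = -(b s)) {O : Set (W m n 1)} (hO : IsOpen O)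
    {ψ : W m n 1 → ℝ} {w : W m n 1 → Fin (m - 1) → ℝ}
    (huid : ∀ A ∈ O, UIDs m n b O ψ A (w A)) :
    ContinuousOn w O ∧ ∃ f : ℕ → W m n 1 → ℝ, (∀ k, ContDiff ℝ 1 (f k)) ∧
      ∀ K ⊆ O, IsCompact K → TendstoUniformlyOn f ψ atTop K ∧
        ∀ j, TendstoUniformlyOn (fun k => Dj m n h0 b (f k) j) (fun A => w A j) atTop K := by
  set wL : W m n 1 → (Fin (m - 1) → ℝ) →L[ℝ] ℝ := fun A =>
    ∑ i, w A i • ContinuousLinearMap.proj (R := ℝ) (φ := fun _ => ℝ) i with hwL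
  have hwLj : ∀ A j, wL A (Pi.single j 1) = w A j := fun A j => by
    simp [hwL, sum_apply, Pi.single_apply]
  have hexp : ∀ A₀ ∈ O, ∀ ε > 0, ∃ r > 0, ExpandsOn (driftβ m n h0 b) (driftγ m n b) ψ
      (wL A₀) A₀ ε r := fun A₀ hA₀ ε hε => expandsOn_of_UIDs h0 hskew hO hA₀ (huid A₀ hA₀) hε
  obtain ⟨hψ, hw⟩ := continuousOn_of_expandsOn hexp
  refine ⟨continuousOn_pi.2 fun j => ?_, ?_⟩
  · simp only [← hwLj]
    exact hw.clm_apply continuousOn_const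
  have : LocallyCompactSpace O := hO.locallyCompactSpace
  set e : CompactExhaustion O := default
  have happ : ∀ k : ℕ, ∃ f : W m n 1 → ℝ, ContDiff ℝ 1 f ∧ ∀ A ∈ ((↑) '' e k : Set (W m n 1)),
      |f A - ψ A| ≤ 1 / ((k : ℝ) + 1) ∧
        ∀ j, |Dj m n h0 b f j A - w A j| ≤ 1 / ((k : ℝ) + 1) := fun k => by
    obtain ⟨f, hf, h⟩ := exists_contDiff_approx hO hψ hw hexp
      ((e.isCompact k).image continuous_subtype_val) (Subtype.coe_image_subset O _)
      (δ := 1 / ((k : ℝ) + 1)) (by positivity)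
    refine ⟨f, hf, fun A hA => ⟨(h A hA).1, fun j => ?_⟩⟩
    have h1 := (h A hA).2 (Pi.single j 1)
    rwa [hwLj, ← Dj_eq, Pi.norm_single, norm_one, mul_one] at h1
  choose f hf hfa using happ
  have hlim : ∀ ε > 0, ∀ᶠ k : ℕ in atTop, 1 / ((k : ℝ) + 1) < ε := fun ε hε =>
    tendsto_one_div_add_atTop_nhds_zero_nat.eventually_lt_const hε
  refine ⟨f, hf, fun K hKO hK => ?_⟩
  have hK' : IsCompact ((↑) ⁻¹' K : Set O) :=
    Topology.IsInducing.subtypeVal.isCompact_preimage_iff (by simpa using hKO) |>.2 hK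
  obtain ⟨N, hN⟩ := e.exists_superset_of_isCompact hK'
  have hmem : ∀ k ≥ N, ∀ A ∈ K, A ∈ ((↑) '' e k : Set (W m n 1)) := fun k hk A hA =>
    ⟨⟨A, hKO hA⟩, e.subset hk (hN hA), rfl⟩
  refine ⟨Metric.tendstoUniformlyOn_iff.2 fun ε hε => ?_,
    fun j => Metric.tendstoUniformlyOn_iff.2 fun ε hε => ?_⟩
  · filter_upwards [hlim ε hε, eventually_ge_atTop N] with k hk hkN A hA
    rw [dist_comm, Real.dist_eq]
    exact ((hfa k A (hmem k hkN A hA)).1).trans_lt hk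
  · filter_upwards [hlim ε hε, eventually_ge_atTop N] with k hk hkN A hA
    rw [dist_comm, Real.dist_eq]
    exact ((hfa k A (hmem k hkN A hA)).2 j).trans_lt hk

theorem integral_Dj_mul {m n : ℕ} (h0 : 0 < m) (b : Fin n → Matrix (Fin m) (Fin m) ℝ)
    {f η : W m n 1 → ℝ} (hf : ContDiff ℝ 1 f) (hη : ContDiff ℝ 1 η) (hηc : HasCompactSupport η)
    (j : Fin (m - 1)) :
    ∫ A, (f A * fderiv ℝ η A ((Pi.single j 1 : Fin (m - 1) → ℝ), (0 : Fin n → ℝ)) +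
      ∑ s, ((1 / 2) * (f A) ^ 2 * b s (idx1 m j) ⟨0, h0⟩ +
          (1 / 2) * (∑ l, A.1 l * b s (idx1 m j) (idx1 m l)) * f A) *
        fderiv ℝ η A ((0 : Fin (m - 1) → ℝ), (Pi.single s 1 : Fin n → ℝ))) =
      -∫ A, Dj m n h0 b f j A * η A := by
  set ℓ : Fin n → (Fin (m - 1) → ℝ) →L[ℝ] ℝ := fun s =>
    ∑ l, ((1 / 2) * b s (idx1 m j) (idx1 m l)) •
      ContinuousLinearMap.proj (R := ℝ) (φ := fun _ => ℝ) l with hℓ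
  have hℓa : ∀ s x, (1 / 2) * ∑ l, x l * b s (idx1 m j) (idx1 m l) = ℓ s x := fun s x => by
    simp only [hℓ, sum_apply, smul_apply, ContinuousLinearMap.proj_apply, smul_eq_mul,
      Finset.mul_sum]
    exact Finset.sum_congr rfl fun l _ => by ring
  have hη' : ∀ v, Continuous fun A => fderiv ℝ η A v := fun v =>
    (hη.continuous_fderiv one_ne_zero).clm_apply continuous_const
  have hf' : ∀ v, Continuous fun A => fderiv ℝ f A v := fun v =>
    (hf.continuous_fderiv one_ne_zero).clm_apply continuous_const
  have hfc := hf.continuous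
  have hvol : (volume : Measure (W m n 1)).IsAddHaarMeasure :=
    Measure.prod.instIsAddHaarMeasure _ _
  have hI : ∀ {F : W m n 1 → ℝ}, Continuous F → Integrable fun A => F A * η A := fun hF =>
    (hF.mul hη.continuous).integrable_of_hasCompactSupport hηc.mul_left
  have hI' : ∀ {F : W m n 1 → ℝ}, Continuous F → ∀ v,
      Integrable fun A => F A * fderiv ℝ η A v := fun hF v =>
    (hF.mul (hη' v)).integrable_of_hasCompactSupport (hηc.fderiv_apply ℝ v).mul_left
  have hP : ∀ s, Continuous fun A : W m n 1 =>
      (1 / 2) * f A ^ 2 * b s (idx1 m j) ⟨0, h0⟩ + ℓ s A.1 * f A := fun s => by fun_prop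
  have hQ : ∀ s, Continuous fun A : W m n 1 =>
      (f A * b s (idx1 m j) ⟨0, h0⟩ + ℓ s A.1) *
        fderiv ℝ f A ((0 : Fin (m - 1) → ℝ), (Pi.single s 1 : Fin n → ℝ)) := fun s => by
    have := hf' ((0 : Fin (m - 1) → ℝ), (Pi.single s 1 : Fin n → ℝ))
    fun_prop
  simp only [hℓa, Dj]
  conv_rhs => simp only [add_mul _ _ (η _), Finset.sum_mul _ _ (η _)]
  rw [integral_add (hI' hfc _) (integrable_finsetSum _ fun s _ => hI' (hP s) _),
    integral_finsetSum _ fun s _ => hI' (hP s) _,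
    integral_add (hI (hf' _)) (integrable_finsetSum _ fun s _ => hI (hQ s)),
    integral_finsetSum _ fun s _ => hI (hQ s),
    integral_mul_fderiv_eq_neg volume hf hη hηc, neg_add, ← Finset.sum_neg_distrib]
  congr 1
  exact Finset.sum_congr rfl fun s _ =>
    integral_burgers_mul_fderiv_eq_neg volume hf hη hηc (b s (idx1 m j) ⟨0, h0⟩) (ℓ s)
      (Pi.single s 1)

theorem integral_of_seq_approx {m n : ℕ} (h0 : 0 < m) (b : Fin n → Matrix (Fin m) (Fin m) ℝ)
    {O : Set (W m n 1)} (hO : IsOpen O) {ψ η : W m n 1 → ℝ} {w : W m n 1 → Fin (m - 1) → ℝ}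
    {f : ℕ → W m n 1 → ℝ} (hf : ∀ k, ContDiff ℝ 1 (f k)) (hη : ContDiff ℝ 1 η)
    (hηc : HasCompactSupport η) (hηO : tsupport η ⊆ O) (j : Fin (m - 1))
    (hfψ : TendstoUniformlyOn f ψ atTop (tsupport η))
    (hfw : TendstoUniformlyOn (fun k => Dj m n h0 b (f k) j) (fun A => w A j) atTop
      (tsupport η)) :
    ∫ A in O, (ψ A * fderiv ℝ η A ((Pi.single j 1 : Fin (m - 1) → ℝ), (0 : Fin n → ℝ)) +
      ∑ s, ((1 / 2) * (ψ A) ^ 2 * b s (idx1 m j) ⟨0, h0⟩ +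
          (1 / 2) * (∑ l, A.1 l * b s (idx1 m j) (idx1 m l)) * ψ A) *
        fderiv ℝ η A ((0 : Fin (m - 1) → ℝ), (Pi.single s 1 : Fin n → ℝ))) =
      -∫ A in O, w A j * η A := by
  have hη' : ∀ v, Continuous fun A => fderiv ℝ η A v := fun v =>
    (hη.continuous_fderiv one_ne_zero).clm_apply continuous_const
  have hη0 : ∀ A ∉ tsupport η, η A = 0 := fun A hA => image_eq_zero_of_notMem_tsupport hA
  have hη0' : ∀ A ∉ tsupport η, fderiv ℝ η A = 0 := fun A hA =>
    image_eq_zero_of_notMem_tsupport fun h => hA (tsupport_fderiv_subset ℝ h)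
  have hDj : ∀ k, Continuous (Dj m n h0 b (f k) j) := fun k => by
    have h1 : ∀ v, Continuous fun A => fderiv ℝ (f k) A v := fun v =>
      ((hf k).continuous_fderiv one_ne_zero).clm_apply continuous_const
    have h2 := (hf k).continuous
    have h3 := fun s : Fin n => h1 ((0 : Fin (m - 1) → ℝ), Pi.single s 1)
    have h4 := h1 (Pi.single j 1, (0 : Fin n → ℝ))
    unfold Dj
    fun_prop
  set Φ : W m n 1 × ℝ → ℝ := fun p =>
    p.2 * fderiv ℝ η p.1 ((Pi.single j 1 : Fin (m - 1) → ℝ), (0 : Fin n → ℝ)) +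
      ∑ s, ((1 / 2) * p.2 ^ 2 * b s (idx1 m j) ⟨0, h0⟩ +
          (1 / 2) * (∑ l, p.1.1 l * b s (idx1 m j) (idx1 m l)) * p.2) *
        fderiv ℝ η p.1 ((0 : Fin (m - 1) → ℝ), (Pi.single s 1 : Fin n → ℝ)) with hΦ
  have hΦc : Continuous Φ := by
    have h3 := fun s : Fin n =>
      (hη' ((0 : Fin (m - 1) → ℝ), Pi.single s 1)).comp (continuous_fst (Y := ℝ))
    have h4 := (hη' (Pi.single j 1, (0 : Fin n → ℝ))).comp (continuous_fst (Y := ℝ))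
    simp only [Function.comp_def] at h3 h4
    fun_prop
  have hΦ0 : ∀ (g : W m n 1 → ℝ), ∀ A ∉ tsupport η, Φ (A, g A) = 0 := fun g A hA => by
    simp [hΦ, hη0' A hA]
  have h1 := tendsto_setIntegral_comp (μ := volume) hηc hΦc
    (fun k => (hf k).continuous.continuousOn) hfψ
  have h2 := tendsto_setIntegral_comp (μ := volume) hηc (Φ := fun p => p.2 * η p.1)
    (by have := hη.continuous; fun_prop) (fun k => (hDj k).continuousOn) hfw
  have h3 : ∀ k, ∫ A in tsupport η, Φ (A, f k A) =
      -∫ A in tsupport η, Dj m n h0 b (f k) j A * η A := fun k => by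
    rw [setIntegral_eq_integral_of_forall_compl_eq_zero (hΦ0 _),
      setIntegral_eq_integral_of_forall_compl_eq_zero fun A hA => by rw [hη0 A hA, mul_zero]]
    exact integral_Dj_mul h0 b (hf k) hη hηc j
  have h4 : ∫ A in O, Φ (A, ψ A) = ∫ A in tsupport η, Φ (A, ψ A) :=
    setIntegral_eq_of_subset_of_forall_sdiff_eq_zero hO.measurableSet hηO fun A hA =>
      hΦ0 ψ A hA.2
  have h5 : ∫ A in O, w A j * η A = ∫ A in tsupport η, w A j * η A :=
    setIntegral_eq_of_subset_of_forall_sdiff_eq_zero hO.measurableSet hηO fun A hA => by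
      rw [hη0 A hA.2, mul_zero]
  simp only [h3] at h1
  rw [h5]
  exact h4.trans (tendsto_nhds_unique h1 h2.neg)

/-- If `ψ` is u.i.d. at every point of the open set `𝒪`, with
intrinsic gradient `w`, then `w` is continuous on `𝒪`, (a) `D_j^ψψ = w_j` holds in
the sense of distributions, and (b) there is a family `(ψ_ε) ⊂ C¹(𝒪)` with
`ψ_ε → ψ` and `D_j^{ψ_ε}ψ_ε → w_j` uniformly on every compact subset of `𝒪` as
`ε → 0⁺`. -/
theorem statement11 (m n : ℕ) (hm : 2 ≤ m) (hn : 1 ≤ n)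
    (b : Fin n → Matrix (Fin m) (Fin m) ℝ)
    (hskew : ∀ s, (b s).transpose = -(b s)) (hind : LinearIndependent ℝ b)
    (O : Set (W m n 1)) (hO : IsOpen O)
    (ψ : W m n 1 → ℝ) (w : W m n 1 → Fin (m - 1) → ℝ)
    (huid : ∀ A ∈ O, UIDs m n b O ψ A (w A)) :
    ContinuousOn w O ∧
    (∀ η : W m n 1 → ℝ, ContDiff ℝ (⊤ : ℕ∞) η → HasCompactSupport η → tsupport η ⊆ O →
      ∀ j : Fin (m - 1),
        (∫ A in O, (ψ A * fderiv ℝ η A ((Pi.single j 1 : Fin (m - 1) → ℝ), (0 : Fin n → ℝ)) +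
          ∑ s, ((1 / 2) * (ψ A) ^ 2 * b s (idx1 m j) ⟨0, by omega⟩ +
              (1 / 2) * (∑ l, A.1 l * b s (idx1 m j) (idx1 m l)) * ψ A) *
            fderiv ℝ η A ((0 : Fin (m - 1) → ℝ), (Pi.single s 1 : Fin n → ℝ)))) =
        -∫ A in O, w A j * η A) ∧
    (∃ ψε : ℝ → W m n 1 → ℝ,
      (∀ ε ∈ Set.Ioo (0:ℝ) 1, ContDiffOn ℝ 1 (ψε ε) O) ∧
      ∀ K ⊆ O, IsCompact K →
        TendstoUniformlyOn ψε ψ (𝓝[>] (0:ℝ)) K ∧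
        ∀ j : Fin (m - 1),
          TendstoUniformlyOn (fun ε => Dj m n (by omega) b (ψε ε) j)
            (fun A => w A j) (𝓝[>] (0:ℝ)) K) := by
  have h0 : 0 < m := by omega
  obtain ⟨hw, f, hf, hlim⟩ := exists_seq_approx h0 hskew hO huid
  refine ⟨hw, fun η hη hηc hηO j => ?_, fun ε => f ⌈ε⁻¹⌉₊, fun ε _ => (hf _).contDiffOn,
    fun K hKO hK => ?_⟩
  · have h := hlim _ hηO hηc
    exact integral_of_seq_approx h0 b hO hf (hη.of_le (by exact_mod_cast le_top)) hηc hηO j h.1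
      (h.2 j)
  · have htend : Tendsto (fun ε : ℝ => ⌈ε⁻¹⌉₊) (𝓝[>] 0) atTop :=
      tendsto_nat_ceil_atTop.comp tendsto_inv_nhdsGT_zero
    have h := hlim K hKO hK
    exact ⟨fun u hu => htend.eventually (h.1 u hu), fun j u hu => htend.eventually (h.2 j u hu)⟩

end Carnot
end
end

section
/- Let 𝒪 ⊂ ℝ^{m−1} × ℝ^n be open, ψ ∈ C(𝒪, ℝ), w = (w₂,…,w_m) ∈ C(𝒪, ℝ^{m−1}), and suppose there is a family (ψ_ε)_{ε∈(0,1)} ⊂ C¹(𝒪, ℝ) such that for every compact K ⊂ 𝒪 and every j = 2,…,m, ψ_ε → ψ and D_j^{ψ_ε}ψ_ε → w_j uniformly on K as ε → 0⁺. Then ψ is a broad* solution of (D₂^ψψ,…,D_m^ψψ) = w in 𝒪. -/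
noncomputable section

open Set Filter Topology MeasureTheory

namespace Carnot

open NNReal in
/-- Picard–Lindelöf for an autonomous field, with a curve that is defined on all of `ℝ`, globally
Lipschitz, and confined to the ball where the field is controlled. -/
theorem exists_lipschitzWith_integralCurve {E : Type*} [NormedAddCommGroup E] [NormedSpace ℝ E]
    [CompleteSpace E] {f : E → E} {x₀ x : E} {a r L K : ℝ≥0} {T : ℝ} (hT : 0 ≤ T)
    (hb : ∀ y ∈ Metric.closedBall x₀ a, ‖f y‖ ≤ L)
    (hl : LipschitzOnWith K f (Metric.closedBall x₀ a)) (hm : L * T ≤ a - r)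
    (hx : x ∈ Metric.closedBall x₀ r) :
    ∃ α : ℝ → E, α 0 = x ∧ LipschitzWith L α ∧ (∀ t, α t ∈ Metric.closedBall x₀ a) ∧
      ∀ t ∈ Ioo (-T) T, HasDerivAt α (f (α t)) t := by
  have hf : IsPicardLindelof (fun _ ↦ f) (⟨0, by simpa using hT⟩ : Icc (-T) T) x₀ a r L K :=
    .of_time_independent hb hl (by simpa using hm)
  obtain ⟨α, hα⟩ := ODE.FunSpace.exists_isFixedPt_next hf hx
  refine ⟨α.compProj, ?_, ?_, fun t ↦ α.compProj_mem_closedBall hf.mul_max_le, fun t ht ↦ ?_⟩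
  · rw [α.compProj_of_mem (by simpa using hT), ← hα, ODE.FunSpace.next_apply₀]
  · simpa using! α.lipschitzWith.comp (LipschitzWith.projIcc (by linarith : -T ≤ T))
  · have ht' := Ioo_subset_Icc_self ht
    have key : HasDerivWithinAt α.compProj (f (α.compProj t)) (Icc (-T) T) t := by
      apply ODE.hasDerivWithinAt_picard_Icc (t₀ := 0) (by simpa using hT) hf.continuousOn_uncurry
        α.continuous_compProj.continuousOn
        (fun _ _ ↦ α.compProj_mem_closedBall hf.mul_max_le) x ht' |>.congr_of_mem _ ht'
      intro s hs
      nth_rw 1 [← hα]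
      rw [ODE.FunSpace.compProj_of_mem hs, ODE.FunSpace.next_apply]
    exact key.hasDerivAt (Icc_mem_nhds ht.1 ht.2)

/-- Composition of uniformly convergent families, when the outer limit is continuous on a compact
set containing the values of the inner family. -/
theorem tendstoUniformlyOn_comp_of_isCompact {ι X Y Z : Type*} [PseudoMetricSpace Y]
    [PseudoMetricSpace Z] {l : Filter ι} {K : Set Y} (hK : IsCompact K) {s : Set X}
    {F : ι → Y → Z} {G : Y → Z} (hF : TendstoUniformlyOn F G l K) (hG : ContinuousOn G K)
    {α : ι → X → Y} {γ : X → Y} (hα : TendstoUniformlyOn α γ l s)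
    (hαK : ∀ i, MapsTo (α i) s K) (hγK : MapsTo γ s K) :
    TendstoUniformlyOn (fun i x ↦ F i (α i x)) (fun x ↦ G (γ x)) l s := by
  have huc := Metric.uniformContinuousOn_iff.1 (hK.uniformContinuousOn_of_continuous hG)
  rw [Metric.tendstoUniformlyOn_iff] at hF hα ⊢
  intro ε hε
  obtain ⟨δ, hδ, hδG⟩ := huc (ε / 2) (half_pos hε)
  filter_upwards [hF (ε / 2) (half_pos hε), hα δ hδ] with i hi hi' x hx
  calc dist (G (γ x)) (F i (α i x))
      ≤ dist (G (γ x)) (G (α i x)) + dist (G (α i x)) (F i (α i x)) := dist_triangle _ _ _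
    _ < ε / 2 + ε / 2 :=
        add_lt_add (hδG _ (hγK hx) _ (hαK i hx) (hi' x hx)) (hi _ (hαK i hx))
    _ = ε := add_halves ε

open NNReal in
/-- A family of `L`-Lipschitz curves in a compact set has a limit along any ultrafilter, uniformly
on compact sets of times. -/
theorem exists_tendstoUniformlyOn_of_lipschitzWith {ι E : Type*} [PseudoMetricSpace E]
    (U : Ultrafilter ι) {K : Set E} (hK : IsCompact K) {L : ℝ≥0} {α : ι → ℝ → E}
    (hL : ∀ i, LipschitzWith L (α i)) (hαK : ∀ i t, α i t ∈ K) {S : Set ℝ} (hS : IsCompact S) :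
    ∃ γ : ℝ → E, (∀ t, γ t ∈ K) ∧ (∀ t, Tendsto (fun i ↦ α i t) U (𝓝 (γ t))) ∧
      TendstoUniformlyOn α γ U S := by
  have hlim (t : ℝ) : ∃ y ∈ K, Tendsto (fun i ↦ α i t) U (𝓝 y) :=
    hK.ultrafilter_le_nhds (U.map fun i ↦ α i t)
      (le_principal_iff.2 (mem_map.2 (univ_mem' fun i ↦ hαK i t)))
  choose γ hγK hγ using hlim
  refine ⟨γ, hγK, hγ, ?_⟩
  have heq : Equicontinuous α := (LipschitzWith.uniformEquicontinuous α L hL).equicontinuous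
  have := (EquicontinuousOn.tendsto_uniformOnFun_iff_pi' (𝔖 := {S}) (by simpa using hS)
    (fun _ _ ↦ heq.equicontinuousOn _) (U : Filter ι) γ).2
    (tendsto_pi_nhds.2 fun t ↦ hγ t)
  exact UniformOnFun.tendsto_iff_tendstoUniformlyOn.1 this S rfl

open NNReal in
/-- If Lipschitz fields `f i` converge uniformly to `V`, and functions `g i` converge to `ψ` while
their derivatives along `f i` converge uniformly to `w`, then `V` has integral curves along which
`ψ` is differentiable with derivative `w`. -/
theorem exists_integralCurve_of_tendstoUniformlyOn {ι E : Type*} [NormedAddCommGroup E]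
    [NormedSpace ℝ E] [ProperSpace E] {l : Filter ι} [l.NeBot] {f : ι → E → E} {V : E → E}
    {g : ι → E → ℝ} {ψ w : E → ℝ} {x₀ x : E} {a r L : ℝ≥0} {T : ℝ} (hT : 0 ≤ T)
    (hm : L * T ≤ a - r) (hx : x ∈ Metric.closedBall x₀ r)
    (hlip : ∀ᶠ i in l, ∃ K, LipschitzOnWith K (f i) (Metric.closedBall x₀ a))
    (hbd : ∀ᶠ i in l, ∀ y ∈ Metric.closedBall x₀ a, ‖f i y‖ ≤ L)
    (hdiff : ∀ᶠ i in l, ∀ y ∈ Metric.closedBall x₀ a, DifferentiableAt ℝ (g i) y)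
    (hV : ContinuousOn V (Metric.closedBall x₀ a))
    (hψ : ContinuousOn ψ (Metric.closedBall x₀ a))
    (hw : ContinuousOn w (Metric.closedBall x₀ a))
    (hfV : TendstoUniformlyOn f V l (Metric.closedBall x₀ a))
    (hgψ : TendstoUniformlyOn g ψ l (Metric.closedBall x₀ a))
    (hdw : TendstoUniformlyOn (fun i y ↦ fderiv ℝ (g i) y (f i y)) w l
      (Metric.closedBall x₀ a)) :
    ∃ γ : ℝ → E, γ 0 = x ∧ (∀ t, γ t ∈ Metric.closedBall x₀ a) ∧
      ∀ t ∈ Ioo (-T) T, HasDerivAt γ (V (γ t)) t ∧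
        HasDerivAt (fun t' ↦ ψ (γ t')) (w (γ t)) t := by
  have hra : (r : ℝ) ≤ a := by nlinarith [mul_nonneg L.2 hT]
  have hK := isCompact_closedBall x₀ (a : ℝ)
  have hex (i : ι) : ∃ α : ℝ → E, α 0 = x ∧ LipschitzWith L α ∧
      (∀ t, α t ∈ Metric.closedBall x₀ a) ∧
      ((∃ K, LipschitzOnWith K (f i) (Metric.closedBall x₀ a)) →
        (∀ y ∈ Metric.closedBall x₀ a, ‖f i y‖ ≤ L) →
        ∀ t ∈ Ioo (-T) T, HasDerivAt α (f i (α t)) t) := by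
    by_cases h : (∃ K, LipschitzOnWith K (f i) (Metric.closedBall x₀ a)) ∧
        ∀ y ∈ Metric.closedBall x₀ a, ‖f i y‖ ≤ L
    · obtain ⟨⟨K, hl⟩, hb⟩ := h
      obtain ⟨α, h0, h1, h2, h3⟩ := exists_lipschitzWith_integralCurve hT hb hl hm hx
      exact ⟨α, h0, h1, h2, fun _ _ ↦ h3⟩
    · exact ⟨fun _ ↦ x, rfl, (LipschitzWith.const x).weaken zero_le,
        fun _ ↦ Metric.closedBall_subset_closedBall hra hx, fun h1 h2 ↦ absurd ⟨h1, h2⟩ h⟩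
  choose α hα0 hαL hαK hα using hex
  let U := Ultrafilter.of l
  have hU : (U : Filter ι) ≤ l := Ultrafilter.of_le l
  obtain ⟨γ, hγK, hγ, hγu⟩ :=
    exists_tendstoUniformlyOn_of_lipschitzWith U hK hαL hαK (isCompact_Icc (a := -T) (b := T))
  have hγu' := hγu.mono (Ioo_subset_Icc_self (a := -T) (b := T))
  have hderiv : ∀ᶠ i in (U : Filter ι), ∀ t ∈ Ioo (-T) T, HasDerivAt (α i) (f i (α i t)) t := by
    filter_upwards [hU hlip, hU hbd] with i h1 h2 using hα i h1 h2
  refine ⟨γ, ?_, hγK, fun t ht ↦ ⟨?_, ?_⟩⟩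
  · refine tendsto_nhds_unique (hγ 0) ?_
    simp [hα0]
  · exact hasDerivAt_of_tendstoUniformlyOn isOpen_Ioo
      (tendstoUniformlyOn_comp_of_isCompact hK (fun u hu ↦ hU (hfV u hu)) hV hγu'
        (fun i t _ ↦ hαK i t) fun t _ ↦ hγK t) hderiv (fun t _ ↦ hγ t) ht
  · refine hasDerivAt_of_tendstoUniformlyOn isOpen_Ioo (f := fun i t ↦ g i (α i t))
      (tendstoUniformlyOn_comp_of_isCompact hK (fun u hu ↦ hU (hdw u hu)) hw hγu'
        (fun i t _ ↦ hαK i t) fun t _ ↦ hγK t) ?_ (fun t ht ↦ ?_) ht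
    · filter_upwards [hderiv, hU hdiff] with i h1 h2 t ht
      exact (h2 _ (hαK i t)).hasFDerivAt.comp_hasDerivAt t (h1 t ht)
    · exact (tendstoUniformlyOn_comp_of_isCompact hK (fun u hu ↦ hU (hgψ u hu)) hψ hγu'
        (fun i t _ ↦ hαK i t) fun t _ ↦ hγK t).tendsto_at ht

theorem norm_le_enormP {d e : ℕ} (P : (Fin d → ℝ) × (Fin e → ℝ)) : ‖P‖ ≤ enormP P := by
  have h1 : 0 ≤ ∑ i, (P.1 i) ^ 2 := Finset.sum_nonneg fun i _ ↦ sq_nonneg _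
  have h2 : 0 ≤ ∑ s, (P.2 s) ^ 2 := Finset.sum_nonneg fun i _ ↦ sq_nonneg _
  refine norm_prod_le_iff.2 ⟨(pi_norm_le_iff_of_nonneg (Real.sqrt_nonneg _)).2 fun i ↦ ?_,
    (pi_norm_le_iff_of_nonneg (Real.sqrt_nonneg _)).2 fun s ↦ ?_⟩
  · refine Real.abs_le_sqrt ?_
    have := Finset.single_le_sum (f := fun i ↦ (P.1 i) ^ 2) (fun i _ ↦ sq_nonneg _)
      (Finset.mem_univ i)
    linarith
  · refine Real.abs_le_sqrt ?_
    have := Finset.single_le_sum (f := fun s ↦ (P.2 s) ^ 2) (fun i _ ↦ sq_nonneg _)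
      (Finset.mem_univ s)
    linarith

theorem enormP_le {d e : ℕ} (P : (Fin d → ℝ) × (Fin e → ℝ)) :
    enormP P ≤ (d + e + 1) * ‖P‖ := by
  have h1 : ∑ i, (P.1 i) ^ 2 ≤ d * ‖P‖ ^ 2 := by
    refine (Finset.sum_le_card_nsmul _ _ (‖P‖ ^ 2) fun i _ ↦ ?_).trans (by simp)
    rw [← sq_abs]
    exact pow_le_pow_left₀ (abs_nonneg _) ((norm_le_pi_norm P.1 i).trans (norm_fst_le P)) 2
  have h2 : ∑ s, (P.2 s) ^ 2 ≤ e * ‖P‖ ^ 2 := by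
    refine (Finset.sum_le_card_nsmul _ _ (‖P‖ ^ 2) fun i _ ↦ ?_).trans (by simp)
    rw [← sq_abs]
    exact pow_le_pow_left₀ (abs_nonneg _) ((norm_le_pi_norm P.2 i).trans (norm_snd_le P)) 2
  refine Real.sqrt_le_iff.2 ⟨by positivity, ?_⟩
  have hd : (0 : ℝ) ≤ d := Nat.cast_nonneg d
  have he : (0 : ℝ) ≤ e := Nat.cast_nonneg e
  calc _ ≤ (d + e : ℝ) * ‖P‖ ^ 2 := by linarith
    _ ≤ (d + e + 1) ^ 2 * ‖P‖ ^ 2 := by gcongr; nlinarith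
    _ = _ := by ring

theorem cballE_subset_closedBall {d e : ℕ} (A : (Fin d → ℝ) × (Fin e → ℝ)) (r : ℝ) :
    cballE A r ⊆ Metric.closedBall A r := fun _ hB ↦
  mem_closedBall_iff_norm.2 ((norm_le_enormP _).trans hB)

theorem closedBall_subset_cballE {d e : ℕ} (A : (Fin d → ℝ) × (Fin e → ℝ)) (r : ℝ) :
    Metric.closedBall A (r / (d + e + 1)) ⊆ cballE A r := fun _ hB ↦ by
  have hB := mem_closedBall_iff_norm.1 hB
  rw [le_div_iff₀' (by positivity)] at hB
  exact (enormP_le _).trans hB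

/-- The vector field `D_j^ψ` on `ℝ^{m-1} × ℝ^n`. -/
def intrinsicField (m n : ℕ) (h0 : 0 < m) (b : Fin n → Matrix (Fin m) (Fin m) ℝ)
    (ψ : W m n 1 → ℝ) (j : Fin (m - 1)) (A : W m n 1) : W m n 1 :=
  (Pi.single j 1, fun s ↦ ψ A * b s (idx1 m j) ⟨0, h0⟩ +
    (1 / 2) * ∑ l, A.1 l * b s (idx1 m j) (idx1 m l))

section intrinsicField

variable {m n : ℕ} (h0 : 0 < m) (b : Fin n → Matrix (Fin m) (Fin m) ℝ) {ψ : W m n 1 → ℝ}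
  (j : Fin (m - 1)) {O : Set (W m n 1)}

theorem Dj_eq_fderiv_intrinsicField (ψ : W m n 1 → ℝ) (A : W m n 1) :
    Dj m n h0 b ψ j A = fderiv ℝ ψ A (intrinsicField m n h0 b ψ j A) := by
  have key (c : Fin n → ℝ) : ((Pi.single j 1, c) : W m n 1) =
      (Pi.single j 1, 0) + ∑ s, c s • ((0, Pi.single s 1) : W m n 1) := by
    refine Prod.ext (by simp [Prod.fst_sum]) ?_
    ext s
    simp [Prod.snd_sum, Finset.sum_apply, Pi.single_apply]
  rw [intrinsicField, key]
  simp only [Dj, map_add, map_sum, map_smul, smul_eq_mul]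

theorem contDiffOn_intrinsicField (hψ : ContDiffOn ℝ 1 ψ O) :
    ContDiffOn ℝ 1 (intrinsicField m n h0 b ψ j) O := by
  unfold intrinsicField
  refine contDiffOn_const.prodMk (contDiffOn_pi.2 fun s ↦ ?_)
  fun_prop

theorem continuousOn_intrinsicField (hψ : ContinuousOn ψ O) :
    ContinuousOn (intrinsicField m n h0 b ψ j) O := by
  unfold intrinsicField
  refine continuousOn_const.prodMk (continuousOn_pi.2 fun s ↦ ?_)
  fun_prop

theorem dist_intrinsicField (φ ψ : W m n 1 → ℝ) (A : W m n 1) :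
    dist (intrinsicField m n h0 b φ j A) (intrinsicField m n h0 b ψ j A) =
      dist (φ A) (ψ A) * ‖fun s ↦ b s (idx1 m j) ⟨0, h0⟩‖ := by
  have : intrinsicField m n h0 b φ j A - intrinsicField m n h0 b ψ j A =
      (0, (φ A - ψ A) • fun s ↦ b s (idx1 m j) ⟨0, h0⟩) :=
    Prod.ext (by simp [intrinsicField]) (by ext s; simp [intrinsicField, sub_mul])
  rw [dist_eq_norm, dist_eq_norm, ← norm_smul, this, Prod.norm_mk, norm_zero,
    max_eq_right (norm_nonneg _)]

theorem tendstoUniformlyOn_intrinsicField {ι : Type*} {l : Filter ι} {φ : ι → W m n 1 → ℝ}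
    {K : Set (W m n 1)} (h : TendstoUniformlyOn φ ψ l K) :
    TendstoUniformlyOn (fun i ↦ intrinsicField m n h0 b (φ i) j)
      (intrinsicField m n h0 b ψ j) l K := by
  rw [Metric.tendstoUniformlyOn_iff] at h ⊢
  intro ε hε
  set c := ‖fun s ↦ b s (idx1 m j) ⟨0, h0⟩‖
  have hc : 0 ≤ c := norm_nonneg _
  filter_upwards [h (ε / (c + 1)) (by positivity)] with i hi A hA
  have hi := hi A hA
  rw [lt_div_iff₀ (by positivity)] at hi
  rw [dist_intrinsicField]
  nlinarith [dist_nonneg (x := ψ A) (y := φ i A)]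

end intrinsicField

/-- If `ψ ∈ C(𝒪)`, `w ∈ C(𝒪,ℝ^{m-1})` and there is a family
`(ψ_ε)_{ε∈(0,1)} ⊂ C¹(𝒪)` with `ψ_ε → ψ` and `D_j^{ψ_ε}ψ_ε → w_j` uniformly on
every compact subset of `𝒪` as `ε → 0⁺`, then `ψ` is a broad* solution of
`(D₂^ψψ,…,D_m^ψψ) = w` in `𝒪`. -/
theorem statement12 (m n : ℕ) (hm : 2 ≤ m) (hn : 1 ≤ n)
    (b : Fin n → Matrix (Fin m) (Fin m) ℝ)
    (hskew : ∀ s, (b s).transpose = -(b s)) (hind : LinearIndependent ℝ b)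
    (O : Set (W m n 1)) (hO : IsOpen O)
    (ψ : W m n 1 → ℝ) (hψ : ContinuousOn ψ O)
    (w : W m n 1 → Fin (m - 1) → ℝ) (hw : ContinuousOn w O)
    (ψε : ℝ → W m n 1 → ℝ)
    (hC1 : ∀ ε ∈ Set.Ioo (0:ℝ) 1, ContDiffOn ℝ 1 (ψε ε) O)
    (hconv : ∀ K ⊆ O, IsCompact K →
      TendstoUniformlyOn ψε ψ (𝓝[>] (0:ℝ)) K ∧
      ∀ j : Fin (m - 1),
        TendstoUniformlyOn (fun ε => Dj m n (by omega) b (ψε ε) j)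
          (fun A => w A j) (𝓝[>] (0:ℝ)) K) :
    IsBroadStar m n (by omega) b O ψ w := by
  intro A hA
  have h0 : 0 < m := by omega
  obtain ⟨R, hR, hRO⟩ := Metric.nhds_basis_closedBall.mem_iff.1 (hO.mem_nhds hA)
  set C : ℝ := ((m - 1 : ℕ) : ℝ) + n + 1
  have hC_one : 1 ≤ C := by
    linarith [Nat.cast_nonneg (α := ℝ) (m - 1), Nat.cast_nonneg (α := ℝ) n]
  set a : ℝ := R / C
  have ha0 : 0 < a := by positivity
  have haR : a ≤ R := div_le_self hR.le hC_one
  set K := Metric.closedBall A a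
  have hK : IsCompact K := isCompact_closedBall A a
  have hKO : K ⊆ O := (Metric.closedBall_subset_closedBall haR).trans hRO
  obtain ⟨M, hM⟩ := hK.exists_bound_of_continuousOn
    (f := fun P j ↦ intrinsicField m n h0 b ψ j P)
    (continuousOn_pi.2 fun j ↦ continuousOn_intrinsicField h0 b j (hψ.mono hKO))
  have hM0 : 0 ≤ M := (norm_nonneg _).trans (hM A (Metric.mem_closedBall_self ha0.le))
  set T : ℝ := a / 2 / (M + 1) with hT
  have hT0 : 0 < T := by positivity
  have hconvK := hconv K hKO hK
  have hpos : ∀ᶠ ε : ℝ in 𝓝[>] 0, ε ∈ Ioo (0 : ℝ) 1 := Ioo_mem_nhdsGT one_pos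
  refine ⟨R, min (a / 2) (T / 2), by positivity,
    (min_le_left _ _).trans_lt (by linarith), (cballE_subset_closedBall A R).trans hRO, fun j ↦ ?_⟩
  have hfV := tendstoUniformlyOn_intrinsicField h0 b j hconvK.1
  have hcurve (B : W m n 1) (hB : B ∈ cballE A (min (a / 2) (T / 2))) :
      ∃ γ : ℝ → W m n 1, γ 0 = B ∧ (∀ t, γ t ∈ K) ∧
        ∀ t ∈ Ioo (-T) T, HasDerivAt γ (intrinsicField m n h0 b ψ j (γ t)) t ∧
          HasDerivAt (fun t' ↦ ψ (γ t')) (w (γ t) j) t := by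
    refine exists_integralCurve_of_tendstoUniformlyOn (l := 𝓝[>] (0 : ℝ)) (g := ψε)
      (f := fun ε ↦ intrinsicField m n h0 b (ψε ε) j)
      (a := ⟨a, ha0.le⟩) (r := ⟨a / 2, by positivity⟩) (L := ⟨M + 1, by positivity⟩)
      (w := fun P ↦ w P j) hT0.le ?_ ?_ ?_ ?_ ?_
      (continuousOn_intrinsicField h0 b j (hψ.mono hKO)) (hψ.mono hKO)
      ((continuousOn_pi.1 hw j).mono hKO) hfV hconvK.1 ?_
    · change (M + 1) * T ≤ a - a / 2
      rw [hT, mul_div_cancel₀ _ (by positivity)]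
      linarith
    · exact Metric.closedBall_subset_closedBall (min_le_left _ _) (cballE_subset_closedBall _ _ hB)
    · filter_upwards [hpos] with ε hε
      exact (contDiffOn_intrinsicField h0 b j ((hC1 ε hε).mono hKO)).exists_lipschitzOnWith
        one_ne_zero (convex_closedBall A a) hK
    · filter_upwards [Metric.tendstoUniformlyOn_iff.1 hfV 1 one_pos] with ε hε P hP
      have h1 := hε P hP
      have h2 := (norm_le_pi_norm _ j).trans (hM P hP)
      rw [dist_comm, dist_eq_norm] at h1
      change _ ≤ M + 1
      linarith [norm_le_norm_add_norm_sub' (intrinsicField m n h0 b (ψε ε) j P)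
        (intrinsicField m n h0 b ψ j P)]
    · filter_upwards [hpos] with ε hε P hP
      exact ((hC1 ε hε).differentiableOn one_ne_zero).differentiableAt (hO.mem_nhds (hKO hP))
    · simpa only [funext (Dj_eq_fderiv_intrinsicField h0 b j _)] using! hconvK.2 j
  choose! γ hγ0 hγK hγ using hcurve
  have hsub : Icc (-min (a / 2) (T / 2)) (min (a / 2) (T / 2)) ⊆ Ioo (-T) T := fun t ht ↦ by
    have := min_le_right (a / 2) (T / 2)
    exact ⟨by linarith [ht.1], by linarith [ht.2]⟩
  refine ⟨fun t B ↦ γ B t, fun B hB ↦ ⟨fun t _ ↦ closedBall_subset_cballE A R (hγK B hB t),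
    hγ0 B hB, fun h t ht ↦ ?_, fun s t ht ↦ ?_, fun t ht ↦ ?_⟩⟩
  · have := hasDerivAt_pi.1 (hγ B hB t (hsub ht)).1.fst h
    simpa [intrinsicField, Pi.single_apply] using this
  · exact hasDerivAt_pi.1 (hγ B hB t (hsub ht)).1.snd s
  · have h0mem : (0 : ℝ) ∈ Icc (-min (a / 2) (T / 2)) (min (a / 2) (T / 2)) := by
      have : 0 ≤ min (a / 2) (T / 2) := by positivity
      exact ⟨by linarith, this⟩
    have hIcc : uIcc 0 t ⊆ Ioo (-T) T := (uIcc_subset_Icc h0mem ht).trans hsub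
    have hcont : ContinuousOn (fun r ↦ w (γ B r) j) (uIcc 0 t) :=
      ((continuousOn_pi.1 hw j).mono hKO).comp
        (fun r hr ↦ (hγ B hB r (hIcc hr)).1.continuousAt.continuousWithinAt)
        fun r _ ↦ hγK B hB r
    rw [intervalIntegral.integral_eq_sub_of_hasDerivAt
      (fun r hr ↦ (hγ B hB r (hIcc hr)).2) hcont.intervalIntegrable, hγ0 B hB]

end Carnot
end
end
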